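/- arXiv:1911.06062 — 6 statements merged into one kernel-verified Lean document; each statement's English description precedes it below -/
import Mathlib

section
/- For every real p ≥ 1, one has 4∫₀¹ (1 − r^p)^(1/p) dr = 4·Γ(1 + 1/p)² / Γ(1 + 2/p), where Γ is the Gamma function. (Thus the area A(p) of the unit disc of the ℓ_p-norm on ℝ² equals 4Γ(1+1/p)²/Γ(1+2/p).) -/
open Real

open Set ProbabilityTheory in
/-- Euler's integral of the first kind, over the reals. -/
theorem integral_rpow_mul_one_sub_rpow {a b : ℝ} (ha : 0 < a) (hb : 0 < b) :
    ∫ x in (0:ℝ)..1, x ^ (a - 1) * (1 - x) ^ (b - 1) =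
      Real.Gamma a * Real.Gamma b / Real.Gamma (a + b) := by
  have h : ((∫ x in (0:ℝ)..1, x ^ (a - 1) * (1 - x) ^ (b - 1) : ℝ) : ℂ) =
      Complex.betaIntegral a b := by
    rw [← intervalIntegral.integral_ofReal, Complex.betaIntegral]
    refine intervalIntegral.integral_congr fun x hx => ?_
    rw [uIcc_of_le zero_le_one] at hx
    have h1 : 0 ≤ 1 - x := sub_nonneg.2 hx.2
    simp only [Complex.ofReal_mul, Complex.ofReal_cpow hx.1, Complex.ofReal_cpow h1]
    push_cast
    rfl
  have h_beta := beta_eq_betaIntegralReal a b ha hb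
  rw [← h, Complex.ofReal_re] at h_beta
  exact h_beta.symm

open MeasureTheory Set in
/-- The substitution `y = r ^ p` on the unit interval. -/
theorem integral_one_sub_rpow_rpow {p : ℝ} (hp : 0 < p) (q : ℝ) :
    ∫ r in (0:ℝ)..1, (1 - r ^ p) ^ q =
      p⁻¹ * ∫ y in (0:ℝ)..1, y ^ (1 / p - 1) * (1 - y) ^ q := by
  have h_subst := integral_comp_rpow_Ioi_of_pos
    (g := (Iic (1:ℝ)).indicator fun y => y ^ (1 / p - 1) * (1 - y) ^ q) hp
  rw [setIntegral_indicator measurableSet_Iic, Ioi_inter_Iic,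
    ← intervalIntegral.integral_of_le zero_le_one] at h_subst
  rw [← h_subst, ← integral_const_mul, intervalIntegral.integral_of_le zero_le_one,
    ← Ioi_inter_Iic, ← setIntegral_indicator measurableSet_Iic]
  refine setIntegral_congr_fun measurableSet_Ioi fun x (hx : 0 < x) => ?_
  have h_iff : x ^ p ≤ 1 ↔ x ≤ 1 := by
    rw [← rpow_le_rpow_iff hx.le zero_le_one hp, one_rpow]
  by_cases h : x ≤ 1
  · have h_mul : x ^ (p - 1) * (x ^ p) ^ (1 / p - 1) = 1 := by
      rw [← rpow_mul hx.le, ← rpow_add hx]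
      convert rpow_zero x using 2
      field
    simp only [indicator, mem_Iic, h_iff, h, if_true, smul_eq_mul]
    calc (1 - x ^ p) ^ q = p⁻¹ * p * (x ^ (p - 1) * (x ^ p) ^ (1 / p - 1)) * (1 - x ^ p) ^ q := by
          rw [h_mul, inv_mul_cancel₀ hp.ne', one_mul, one_mul]
      _ = _ := by ring
  · simp [indicator, h_iff, h]

/-- For every real `p ≥ 1`,
`4∫₀¹ (1 − r^p)^(1/p) dr = 4·Γ(1 + 1/p)² / Γ(1 + 2/p)`. -/
theorem area_lp_disc_eq_gamma (p : ℝ) (hp : 1 ≤ p) :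
    4 * ∫ r in (0:ℝ)..1, (1 - r ^ p) ^ (1 / p) =
      4 * Real.Gamma (1 + 1 / p) ^ 2 / Real.Gamma (1 + 2 / p) := by
  have hp0 : 0 < p := by linarith
  have hp1 : 0 < 1 / p := by positivity
  have h_beta := integral_rpow_mul_one_sub_rpow hp1 (add_pos one_pos hp1)
  have h_add : 1 / p + (1 + 1 / p) = 1 + 2 / p := by ring
  have h_Gamma : Real.Gamma (1 + 1 / p) = p⁻¹ * Real.Gamma (1 / p) := by
    rw [add_comm, Real.Gamma_add_one hp1.ne', one_div]
  rw [add_sub_cancel_left, h_add] at h_beta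
  rw [integral_one_sub_rpow_rpow hp0, h_beta, h_Gamma]
  ring
end

section
/- For every real p ≥ 1, the function g_p is strictly decreasing on the interval [0, (1/4)^(1/p)]. -/
open Real

/-- `r₋(v) = (1/2 − √(1/4 − v^p))^(1/p)`. -/
noncomputable def rMinus (p v : ℝ) : ℝ := (1 / 2 - Real.sqrt (1 / 4 - v ^ p)) ^ (1 / p)

/-- `r₊(v) = (1/2 + √(1/4 − v^p))^(1/p)`. -/
noncomputable def rPlus (p v : ℝ) : ℝ := (1 / 2 + Real.sqrt (1 / 4 - v ^ p)) ^ (1 / p)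

/-- `g_p(v) = 2∫_{r₋(v)}^{r₊(v)} √((1 − r^p)^(2/p) − v²/r²) dr`. -/
noncomputable def g (p v : ℝ) : ℝ :=
  2 * ∫ r in rMinus p v..rPlus p v, Real.sqrt ((1 - r ^ p) ^ (2 / p) - v ^ 2 / r ^ 2)

/-- The integrand defining `g` is interval integrable inside `[0, 1]`, being measurable and
bounded by `1`. -/
theorem intervalIntegrable_sqrt_sub (p v : ℝ) (hp : 0 < p) {a b : ℝ} (ha : 0 ≤ a) (hab : a ≤ b)
    (hb : b ≤ 1) :
    IntervalIntegrable (fun r : ℝ => Real.sqrt ((1 - r ^ p) ^ (2 / p) - v ^ 2 / r ^ 2))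
      MeasureTheory.volume a b := by
  have hmeas : Measurable
      (fun r : ℝ => Real.sqrt ((1 - r ^ p) ^ (2 / p) - v ^ 2 / r ^ 2)) := by fun_prop
  refine (intervalIntegrable_const (c := (1 : ℝ))).mono_fun' hmeas.aestronglyMeasurable ?_
  refine (MeasureTheory.ae_restrict_iff' measurableSet_uIoc).2 (Filter.Eventually.of_forall ?_)
  intro r hr
  rw [Set.uIoc_of_le hab] at hr
  have hr0 : 0 ≤ r := ha.trans hr.1.le
  have h1 : r ^ p ≤ 1 := Real.rpow_le_one hr0 (hr.2.trans hb) hp.le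
  have h0 : 0 ≤ r ^ p := Real.rpow_nonneg hr0 p
  have h2 : (1 - r ^ p) ^ (2 / p) ≤ 1 :=
    Real.rpow_le_one (by linarith) (by linarith) (by positivity)
  have h3 : 0 ≤ v ^ 2 / r ^ 2 := by positivity
  beta_reduce
  rw [Real.norm_of_nonneg (Real.sqrt_nonneg _)]
  exact Real.sqrt_le_one.2 (by linarith)

theorem rMinus_nonneg (p v : ℝ) (hv : 0 ≤ v) : 0 ≤ rMinus p v := by
  have h : Real.sqrt (1 / 4 - v ^ p) ≤ 1 / 2 :=
    Real.sqrt_le_iff.2 ⟨by norm_num, by linarith [Real.rpow_nonneg hv p]⟩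
  exact Real.rpow_nonneg (by linarith) _

theorem rPlus_le_one (p v : ℝ) (hp : 0 ≤ p) (hv : 0 ≤ v) : rPlus p v ≤ 1 := by
  have h : Real.sqrt (1 / 4 - v ^ p) ≤ 1 / 2 :=
    Real.sqrt_le_iff.2 ⟨by norm_num, by linarith [Real.rpow_nonneg hv p]⟩
  exact Real.rpow_le_one (by positivity) (by linarith) (by positivity)

theorem rMinus_le_rPlus (p v : ℝ) (hp : 0 ≤ p) (hv : 0 ≤ v) : rMinus p v ≤ rPlus p v := by
  have h : Real.sqrt (1 / 4 - v ^ p) ≤ 1 / 2 :=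
    Real.sqrt_le_iff.2 ⟨by norm_num, by linarith [Real.rpow_nonneg hv p]⟩
  have h0 := Real.sqrt_nonneg (1 / 4 - v ^ p)
  exact Real.rpow_le_rpow (by linarith) (by linarith) (by positivity)

theorem rMinus_lt_rPlus (p v : ℝ) (hp : 0 < p) (hv : 0 ≤ v) (hvp : v ^ p < 1 / 4) :
    rMinus p v < rPlus p v := by
  have h : Real.sqrt (1 / 4 - v ^ p) ≤ 1 / 2 :=
    Real.sqrt_le_iff.2 ⟨by norm_num, by linarith [Real.rpow_nonneg hv p]⟩
  have h0 : 0 < Real.sqrt (1 / 4 - v ^ p) := Real.sqrt_pos.2 (by linarith)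
  exact Real.rpow_lt_rpow (by linarith) (by linarith) (by positivity)

theorem rMinus_mono (p : ℝ) (hp : 0 ≤ p) {v w : ℝ} (hv : 0 ≤ v) (hvw : v ≤ w) :
    rMinus p v ≤ rMinus p w := by
  have h : Real.sqrt (1 / 4 - v ^ p) ≤ 1 / 2 :=
    Real.sqrt_le_iff.2 ⟨by norm_num, by linarith [Real.rpow_nonneg hv p]⟩
  have h1 : Real.sqrt (1 / 4 - w ^ p) ≤ Real.sqrt (1 / 4 - v ^ p) :=
    Real.sqrt_le_sqrt (by linarith [Real.rpow_le_rpow hv hvw hp])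
  exact Real.rpow_le_rpow (by linarith) (by linarith) (by positivity)

theorem rPlus_anti (p : ℝ) (hp : 0 ≤ p) {v w : ℝ} (hv : 0 ≤ v) (hvw : v ≤ w) :
    rPlus p w ≤ rPlus p v := by
  have h1 : Real.sqrt (1 / 4 - w ^ p) ≤ Real.sqrt (1 / 4 - v ^ p) :=
    Real.sqrt_le_sqrt (by linarith [Real.rpow_le_rpow hv hvw hp])
  exact Real.rpow_le_rpow (by positivity) (by linarith) (by positivity)

/-- The radicand is positive strictly between `r₋(v)` and `r₊(v)`. -/
theorem radicand_pos (p v r : ℝ) (hp : 0 < p) (hv : 0 ≤ v) (hvp : v ^ p ≤ 1 / 4)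
    (hr : r ∈ Set.Ioo (rMinus p v) (rPlus p v)) :
    0 < (1 - r ^ p) ^ (2 / p) - v ^ 2 / r ^ 2 := by
  have hr0 : 0 < r := (rMinus_nonneg p v hv).trans_lt hr.1
  have hs : Real.sqrt (1 / 4 - v ^ p) ≤ 1 / 2 :=
    Real.sqrt_le_iff.2 ⟨by norm_num, by linarith [Real.rpow_nonneg hv p]⟩
  have hsq : Real.sqrt (1 / 4 - v ^ p) ^ 2 = 1 / 4 - v ^ p := Real.sq_sqrt (by linarith)
  have hlow : 1 / 2 - Real.sqrt (1 / 4 - v ^ p) < r ^ p := by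
    have h := Real.rpow_lt_rpow (rMinus_nonneg p v hv) hr.1 hp
    rwa [rMinus, ← Real.rpow_mul (by linarith), one_div_mul_cancel hp.ne', Real.rpow_one] at h
  have hupp : r ^ p < 1 / 2 + Real.sqrt (1 / 4 - v ^ p) := by
    have h := Real.rpow_lt_rpow hr0.le hr.2 hp
    rwa [rPlus, ← Real.rpow_mul (by positivity), one_div_mul_cancel hp.ne', Real.rpow_one] at h
  have hmul : v ^ p < (1 - r ^ p) * r ^ p := by nlinarith
  have hpow : ∀ x : ℝ, 0 ≤ x → (x ^ p) ^ (2 / p) = x ^ 2 := fun x hx => by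
    rw [← Real.rpow_mul hx, mul_div_cancel₀ _ hp.ne', Real.rpow_two]
  have h := Real.rpow_lt_rpow (Real.rpow_nonneg hv p) hmul (z := 2 / p) (by positivity)
  rw [Real.mul_rpow (by linarith) (Real.rpow_nonneg hr0.le p), hpow v hv, hpow r hr0.le] at h
  rw [sub_pos, div_lt_iff₀ (by positivity)]
  exact h

/-- for every real `p ≥ 1`, `g_p` is strictly decreasing on
`[0, (1/4)^(1/p)]`. -/
theorem g_strictAntiOn (p : ℝ) (hp : 1 ≤ p) :
    StrictAntiOn (g p) (Set.Icc 0 ((1 / 4 : ℝ) ^ (1 / p))) := by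
  have hp0 : 0 < p := one_pos.trans_le hp
  rintro v ⟨hv, -⟩ w ⟨hw, hw'⟩ hvw
  have hvwp : v ^ p < w ^ p := Real.rpow_lt_rpow hv hvw hp0
  have hwp : w ^ p ≤ 1 / 4 := by
    have h := Real.rpow_le_rpow hw hw' hp0.le
    rwa [← Real.rpow_mul (by norm_num), one_div_mul_cancel hp0.ne', Real.rpow_one] at h
  have hlt := rMinus_lt_rPlus p v hp0 hv (hvwp.trans_le hwp)
  have hint : ∀ u : ℝ, IntervalIntegrable
      (fun r : ℝ => Real.sqrt ((1 - r ^ p) ^ (2 / p) - u ^ 2 / r ^ 2))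
      MeasureTheory.volume (rMinus p v) (rPlus p v) := fun u =>
    intervalIntegrable_sqrt_sub p u hp0 (rMinus_nonneg p v hv) hlt.le
      (rPlus_le_one p v hp0.le hv)
  have hsub := intervalIntegral.integral_mono_interval (rMinus_mono p hp0.le hv hvw.le)
    (rMinus_le_rPlus p w hp0.le hw) (rPlus_anti p hp0.le hv hvw.le)
    (Filter.Eventually.of_forall fun r => Real.sqrt_nonneg _) (hint w)
  have hpos := intervalIntegral.intervalIntegral_pos_of_pos_on ((hint v).sub (hint w))
    (fun r hr => by
      have hr0 : 0 < r := (rMinus_nonneg p v hv).trans_lt hr.1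
      refine sub_pos.2 ((Real.sqrt_lt_sqrt_iff_of_pos
        (radicand_pos p v r hp0 hv (hvwp.le.trans hwp) hr)).2 ?_)
      gcongr) hlt
  rw [intervalIntegral.integral_sub (hint v) (hint w)] at hpos
  unfold g
  linarith
end

section
/- For every real p with 1 < p < 2, the function g_p is strictly concave on the interval (0, (1/4)^(1/p)). -/
open Real

open MeasureTheory

/-- The two solutions `r` of `r ^ p * (1 - r ^ p) = s ^ p`, for `ε = 1` and `ε = -1`. -/
noncomputable def rBranch (ε p s : ℝ) : ℝ := (1 / 2 + ε * √(1 / 4 - s ^ p)) ^ (1 / p)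

lemma rBranch_one (p s : ℝ) : rBranch 1 p s = rPlus p s := by simp [rBranch, rPlus]

lemma rBranch_neg_one (p s : ℝ) : rBranch (-1) p s = rMinus p s := by
  simp [rBranch, rMinus, sub_eq_add_neg]

lemma quarter_rpow_rpow {p : ℝ} (hp : 0 < p) : ((1 / 4 : ℝ) ^ (1 / p)) ^ p = 1 / 4 := by
  rw [← Real.rpow_mul (by norm_num), one_div_mul_cancel hp.ne', Real.rpow_one]

lemma rpow_lt_quarter {p s : ℝ} (hp : 0 < p) (hs : 0 ≤ s) (hsS : s < (1 / 4 : ℝ) ^ (1 / p)) :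
    s ^ p < 1 / 4 := by
  simpa only [quarter_rpow_rpow hp] using Real.rpow_lt_rpow hs hsS hp

lemma sqrt_quarter_sub_rpow_lt {p s : ℝ} (hs : 0 < s) : √(1 / 4 - s ^ p) < 1 / 2 := by
  rw [Real.sqrt_lt' (by norm_num)]
  linarith [Real.rpow_pos_of_pos hs p]

lemma rBranch_base_pos {ε p s : ℝ} (hε : ε = 1 ∨ ε = -1) (hs : 0 < s) :
    0 < 1 / 2 + ε * √(1 / 4 - s ^ p) := by
  have h1 := sqrt_quarter_sub_rpow_lt (p := p) hs
  have h2 := Real.sqrt_nonneg (1 / 4 - s ^ p)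
  rcases hε with rfl | rfl <;> linarith

lemma sqrt_quarter_sub_rpow_strictAntiOn {p : ℝ} (hp : 0 < p) :
    StrictAntiOn (fun s : ℝ => √(1 / 4 - s ^ p)) (Set.Icc 0 ((1 / 4 : ℝ) ^ (1 / p))) := by
  intro x hx y hy hxy
  have hy' : y ^ p ≤ 1 / 4 := by
    simpa only [quarter_rpow_rpow hp] using Real.rpow_le_rpow hy.1 hy.2 hp.le
  exact Real.sqrt_lt_sqrt (by linarith) (by linarith [Real.rpow_lt_rpow hx.1 hxy hp])

lemma continuousOn_rBranch {ε p : ℝ} (hp : 0 < p) (a b : ℝ) :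
    ContinuousOn (rBranch ε p) (Set.Icc a b) := by
  have h : Continuous (rBranch ε p) := by
    unfold rBranch
    have hp' : 0 ≤ 1 / p := by positivity
    refine Continuous.rpow_const ?_ fun _ => Or.inr hp'
    have := Real.continuous_rpow_const hp.le
    fun_prop
  exact h.continuousOn

lemma rPlus_strictAntiOn {p a : ℝ} (hp : 0 < p) (ha : 0 < a) :
    StrictAntiOn (rBranch 1 p) (Set.Icc a ((1 / 4 : ℝ) ^ (1 / p))) := by
  intro x hx y hy hxy
  have := sqrt_quarter_sub_rpow_strictAntiOn hp ⟨ha.le.trans hx.1, hx.2⟩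
    ⟨ha.le.trans hy.1, hy.2⟩ hxy
  have hy0 := rBranch_base_pos (p := p) (Or.inl rfl) (ha.trans_le hy.1)
  exact Real.rpow_lt_rpow hy0.le (by linarith) (by positivity)

lemma rMinus_strictMonoOn {p a : ℝ} (hp : 0 < p) (ha : 0 < a) :
    StrictMonoOn (rBranch (-1) p) (Set.Icc a ((1 / 4 : ℝ) ^ (1 / p))) := by
  intro x hx y hy hxy
  have := sqrt_quarter_sub_rpow_strictAntiOn hp ⟨ha.le.trans hx.1, hx.2⟩
    ⟨ha.le.trans hy.1, hy.2⟩ hxy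
  have hx0 := rBranch_base_pos (p := p) (Or.inr rfl) (ha.trans_le hx.1)
  exact Real.rpow_lt_rpow hx0.le (by linarith) (by positivity)

lemma rBranch_quarter {ε p : ℝ} (hp : 0 < p) :
    rBranch ε p ((1 / 4 : ℝ) ^ (1 / p)) = (1 / 2) ^ (1 / p) := by
  simp only [rBranch, quarter_rpow_rpow hp]
  simp

lemma rPlus_image {p a : ℝ} (hp : 0 < p) (ha : 0 < a) (haS : a < (1 / 4 : ℝ) ^ (1 / p)) :
    rBranch 1 p '' Set.Ioo a ((1 / 4 : ℝ) ^ (1 / p)) =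
      Set.Ioo ((1 / 2) ^ (1 / p)) (rPlus p a) := by
  rw [← rBranch_one, ← rBranch_quarter (ε := 1) hp]
  refine Set.Subset.antisymm ?_ (intermediate_value_Ioo' haS.le (continuousOn_rBranch hp _ _))
  rintro _ ⟨s, hs, rfl⟩
  exact ⟨rPlus_strictAntiOn hp ha ⟨hs.1.le, hs.2.le⟩ ⟨haS.le, le_rfl⟩ hs.2,
    rPlus_strictAntiOn hp ha ⟨le_rfl, haS.le⟩ ⟨hs.1.le, hs.2.le⟩ hs.1⟩

lemma rMinus_image {p a : ℝ} (hp : 0 < p) (ha : 0 < a) (haS : a < (1 / 4 : ℝ) ^ (1 / p)) :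
    rBranch (-1) p '' Set.Ioo a ((1 / 4 : ℝ) ^ (1 / p)) =
      Set.Ioo (rMinus p a) ((1 / 2) ^ (1 / p)) := by
  rw [← rBranch_neg_one, ← rBranch_quarter (ε := -1) hp]
  refine Set.Subset.antisymm ?_ (intermediate_value_Ioo haS.le (continuousOn_rBranch hp _ _))
  rintro _ ⟨s, hs, rfl⟩
  exact ⟨rMinus_strictMonoOn hp ha ⟨le_rfl, haS.le⟩ ⟨hs.1.le, hs.2.le⟩ hs.1,
    rMinus_strictMonoOn hp ha ⟨hs.1.le, hs.2.le⟩ ⟨haS.le, le_rfl⟩ hs.2⟩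

lemma hasDerivAt_rBranch {ε p s : ℝ} (hε : ε = 1 ∨ ε = -1) (hp : 0 < p) (hs : 0 < s)
    (hsS : s < (1 / 4 : ℝ) ^ (1 / p)) :
    HasDerivAt (rBranch ε p)
      (-ε * (s ^ (p - 1) / (2 * √(1 / 4 - s ^ p)) *
        (rBranch ε p s / (1 / 2 + ε * √(1 / 4 - s ^ p))))) s := by
  have hx := rBranch_base_pos (p := p) hε hs
  have hD : 0 < 1 / 4 - s ^ p := by linarith [rpow_lt_quarter hp hs.le hsS]
  have h1 := ((((Real.hasDerivAt_rpow_const (p := p) (Or.inl hs.ne')).const_sub (1 / 4)).sqrt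
    hD.ne').const_mul ε).const_add (1 / 2)
  refine (h1.rpow_const (p := 1 / p) (Or.inl hx.ne')).congr_deriv ?_
  have := Real.sqrt_pos.2 hD
  rw [Real.rpow_sub_one hx.ne', ← rBranch]
  field_simp

lemma integrand_rBranch {ε p s a : ℝ} (hε : ε = 1 ∨ ε = -1) (hp : 0 < p) (hs : 0 < s)
    (hsS : s < (1 / 4 : ℝ) ^ (1 / p)) :
    √((1 - rBranch ε p s ^ p) ^ (2 / p) - a ^ 2 / rBranch ε p s ^ 2) =
      √(s ^ 2 - a ^ 2) / rBranch ε p s := by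
  have hx := rBranch_base_pos (p := p) hε hs
  have hD : 0 < 1 / 4 - s ^ p := by linarith [rpow_lt_quarter hp hs.le hsS]
  have hr : 0 < rBranch ε p s := Real.rpow_pos_of_pos hx _
  have hrp : rBranch ε p s ^ p = 1 / 2 + ε * √(1 / 4 - s ^ p) := by
    rw [rBranch, ← Real.rpow_mul hx.le, one_div_mul_cancel hp.ne', Real.rpow_one]
  have h1 : 1 - rBranch ε p s ^ p = (s / rBranch ε p s) ^ p := by
    rw [Real.div_rpow hs.le hr.le, eq_div_iff (by positivity), hrp]
    have hsq := Real.mul_self_sqrt hD.le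
    have hεε : ε * ε = 1 := by rcases hε with rfl | rfl <;> norm_num
    linear_combination (-1) * hsq - (√(1 / 4 - s ^ p)) ^ 2 * hεε
  rw [h1, ← Real.rpow_mul (by positivity), mul_div_cancel₀ _ hp.ne', Real.rpow_two, div_pow,
    ← sub_div, Real.sqrt_div' _ (sq_nonneg _), Real.sqrt_sq hr.le]

lemma lintegral_rBranch {ε p a : ℝ} (hε : ε = 1 ∨ ε = -1) (hp : 0 < p) (ha : 0 < a)
    (hinj : Set.InjOn (rBranch ε p) (Set.Ioo a ((1 / 4 : ℝ) ^ (1 / p)))) :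
    ∫⁻ r in rBranch ε p '' Set.Ioo a ((1 / 4 : ℝ) ^ (1 / p)),
        ENNReal.ofReal (√((1 - r ^ p) ^ (2 / p) - a ^ 2 / r ^ 2)) =
      ∫⁻ s in Set.Ioo a ((1 / 4 : ℝ) ^ (1 / p)), ENNReal.ofReal
        (s ^ (p - 1) * √(s ^ 2 - a ^ 2) /
          (2 * √(1 / 4 - s ^ p) * (1 / 2 + ε * √(1 / 4 - s ^ p)))) := by
  rw [lintegral_image_eq_lintegral_abs_deriv_mul measurableSet_Ioo
    (fun s hs => (hasDerivAt_rBranch hε hp (ha.trans hs.1) hs.2).hasDerivWithinAt) hinj]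
  refine setLIntegral_congr_fun measurableSet_Ioo fun s hs => ?_
  have hs0 := ha.trans hs.1
  have hx := rBranch_base_pos (p := p) hε hs0
  have hD : 0 < √(1 / 4 - s ^ p) :=
    Real.sqrt_pos.2 (by linarith [rpow_lt_quarter hp hs0.le hs.2])
  have hr : 0 < rBranch ε p s := Real.rpow_pos_of_pos hx _
  have hε' : |-ε| = 1 := by rcases hε with rfl | rfl <;> simp
  rw [← ENNReal.ofReal_mul (abs_nonneg _), integrand_rBranch hε hp hs0 hs.2, abs_mul, hε',
    one_mul, abs_of_pos (by positivity)]
  congr 1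
  field_simp

lemma g_eq_toReal_lintegral {p a : ℝ} (hp : 0 < p) (ha : 0 < a)
    (haS : a < (1 / 4 : ℝ) ^ (1 / p)) :
    g p a = (∫⁻ s in Set.Ioo a ((1 / 4 : ℝ) ^ (1 / p)),
      ENNReal.ofReal (√(s ^ 2 - a ^ 2) / (s * √(1 / 4 - s ^ p)))).toReal := by
  have hm : rMinus p a < (1 / 2) ^ (1 / p) := by
    simpa only [rBranch_neg_one, rBranch_quarter hp] using
      rMinus_strictMonoOn hp ha ⟨le_rfl, haS.le⟩ ⟨haS.le, le_rfl⟩ haS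
  have hM : (1 / 2) ^ (1 / p) < rPlus p a := by
    simpa only [rBranch_one, rBranch_quarter hp] using
      rPlus_strictAntiOn hp ha ⟨le_rfl, haS.le⟩ ⟨haS.le, le_rfl⟩ haS
  have hmeas : Measurable fun r : ℝ => √((1 - r ^ p) ^ (2 / p) - a ^ 2 / r ^ 2) := by fun_prop
  have two_mul_toReal (A : ENNReal) : 2 * A.toReal = (2 * A).toReal := by simp
  rw [g, intervalIntegral.integral_of_le (hm.trans hM).le, integral_eq_lintegral_of_nonneg_ae
    (Filter.Eventually.of_forall fun _ => Real.sqrt_nonneg _) hmeas.aestronglyMeasurable,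
    ← Set.Ioc_union_Ioc_eq_Ioc hm.le hM.le,
    lintegral_union measurableSet_Ioc (Set.Ioc_disjoint_Ioc_of_le le_rfl),
    ← setLIntegral_congr Ioo_ae_eq_Ioc, ← setLIntegral_congr Ioo_ae_eq_Ioc,
    ← rPlus_image hp ha haS, ← rMinus_image hp ha haS,
    lintegral_rBranch (Or.inl rfl) hp ha
      ((rPlus_strictAntiOn hp ha).injOn.mono Set.Ioo_subset_Icc_self),
    lintegral_rBranch (Or.inr rfl) hp ha
      ((rMinus_strictMonoOn hp ha).injOn.mono Set.Ioo_subset_Icc_self),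
    ← lintegral_add_left (by fun_prop), two_mul_toReal,
    ← lintegral_const_mul _ (by fun_prop)]
  congr 1
  refine setLIntegral_congr_fun measurableSet_Ioo fun s hs => ?_
  have hs0 := ha.trans hs.1
  have hx₁ := rBranch_base_pos (p := p) (Or.inl rfl) hs0
  have hx₂ := rBranch_base_pos (p := p) (Or.inr rfl) hs0
  have hD' : 0 < 1 / 4 - s ^ p := by linarith [rpow_lt_quarter hp hs0.le hs.2]
  have hD : 0 < √(1 / 4 - s ^ p) := Real.sqrt_pos.2 hD'
  have hsq := Real.mul_self_sqrt hD'.le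
  have hsp : s ^ p = s ^ (p - 1) * s := by
    rw [Real.rpow_sub_one hs0.ne', div_mul_cancel₀ _ hs0.ne']
  have hsp' : 0 < s ^ (p - 1) := by positivity
  rw [← ENNReal.ofReal_add (by positivity) (by positivity), ← ENNReal.ofReal_ofNat 2,
    ← ENNReal.ofReal_mul (by norm_num)]
  congr 1
  have hprod : (1 / 2 + -1 * √(1 / 4 - s ^ p)) * (1 / 2 + 1 * √(1 / 4 - s ^ p)) =
      s ^ (p - 1) * s := by
    rw [← hsp]
    linear_combination -hsq
  generalize √(1 / 4 - s ^ p) = D at *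
  have hsum : (1 / 2 + -1 * D) + (1 / 2 + 1 * D) = 1 := by ring
  generalize 1 / 2 + -1 * D = x at *
  generalize 1 / 2 + 1 * D = y at *
  rw [div_add_div _ _ (by positivity) (by positivity), ← mul_div_assoc,
    div_eq_div_iff (by positivity) (by positivity)]
  linear_combination 4 * D ^ 2 * s * s ^ (p - 1) * √(s ^ 2 - a ^ 2) * hsum -
    4 * D ^ 2 * √(s ^ 2 - a ^ 2) * hprod

lemma ofReal_sqrt_sq_sub_sq {a s : ℝ} (ha : 0 < a) (has : a < s) :
    ENNReal.ofReal (√(s ^ 2 - a ^ 2)) =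
      ∫⁻ w in Set.Ioo a s, ENNReal.ofReal (w / √(s ^ 2 - w ^ 2)) := by
  have hc : ContinuousOn (fun w => -√(s ^ 2 - w ^ 2)) (Set.Icc a s) := by fun_prop
  have hd : ∀ w ∈ Set.Ioo a s,
      HasDerivAt (fun w => -√(s ^ 2 - w ^ 2)) (w / √(s ^ 2 - w ^ 2)) w := by
    intro w hw
    have hpos : 0 < s ^ 2 - w ^ 2 := by nlinarith [hw.1, hw.2]
    have h1 : HasDerivAt (fun w => s ^ 2 - w ^ 2) (-(2 * w)) w := by
      simpa using (hasDerivAt_pow 2 w).const_sub (s ^ 2)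
    refine (h1.sqrt hpos.ne').fun_neg.congr_deriv ?_
    have := Real.sqrt_pos.2 hpos
    field_simp
  have hn : ∀ w ∈ Set.Ioo a s, 0 ≤ w / √(s ^ 2 - w ^ 2) := fun w hw =>
    div_nonneg (ha.trans hw.1).le (Real.sqrt_nonneg _)
  have hi := intervalIntegral.integrableOn_deriv_of_nonneg hc hd hn
  have hint := intervalIntegral.integral_eq_sub_of_hasDerivAt_of_le has.le hc hd
    ((intervalIntegrable_iff_integrableOn_Ioc_of_le has.le).2 hi)
  rw [intervalIntegral.integral_of_le has.le, integral_Ioc_eq_integral_Ioo] at hint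
  rw [← ofReal_integral_eq_lintegral_ofReal (hi.mono_set Set.Ioo_subset_Ioc_self), hint]
  · simp
  · exact (ae_restrict_iff' measurableSet_Ioo).2 (Filter.Eventually.of_forall hn)

lemma lintegral_triangle_swap {a S : ℝ} {F : ℝ → ℝ → ENNReal}
    (hF : Measurable (Function.uncurry F)) :
    ∫⁻ s in Set.Ioo a S, ∫⁻ w in Set.Ioo a s, F s w =
      ∫⁻ w in Set.Ioo a S, ∫⁻ s in Set.Ioo w S, F s w := by
  have hT : MeasurableSet {z : ℝ × ℝ | a < z.2 ∧ z.2 < z.1 ∧ z.1 < S} :=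
    (measurableSet_lt measurable_const measurable_snd).inter
      ((measurableSet_lt measurable_snd measurable_fst).inter
        (measurableSet_lt measurable_fst measurable_const))
  have key := lintegral_lintegral_swap (μ := volume) (ν := volume)
    (f := fun s w => {z : ℝ × ℝ | a < z.2 ∧ z.2 < z.1 ∧ z.1 < S}.indicator
      (Function.uncurry F) (s, w)) (hF.indicator hT).aemeasurable
  have hl : ∀ s, ∫⁻ w, {z : ℝ × ℝ | a < z.2 ∧ z.2 < z.1 ∧ z.1 < S}.indicator
      (Function.uncurry F) (s, w) =
      (Set.Ioo a S).indicator (fun s => ∫⁻ w in Set.Ioo a s, F s w) s := by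
    intro s
    by_cases hs : s ∈ Set.Ioo a S
    · rw [Set.indicator_of_mem hs, ← lintegral_indicator measurableSet_Ioo]
      refine lintegral_congr fun w => ?_
      simp [Set.indicator_apply, hs.2]
    · rw [Set.indicator_of_notMem hs]
      refine (lintegral_congr fun w => Set.indicator_of_notMem ?_ _).trans lintegral_zero
      rintro ⟨h1, h2, h3⟩
      exact hs ⟨h1.trans h2, h3⟩
  have hr : ∀ w, ∫⁻ s, {z : ℝ × ℝ | a < z.2 ∧ z.2 < z.1 ∧ z.1 < S}.indicator
      (Function.uncurry F) (s, w) =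
      (Set.Ioo a S).indicator (fun w => ∫⁻ s in Set.Ioo w S, F s w) w := by
    intro w
    by_cases hw : w ∈ Set.Ioo a S
    · rw [Set.indicator_of_mem hw, ← lintegral_indicator measurableSet_Ioo]
      refine lintegral_congr fun s => ?_
      simp [Set.indicator_apply, hw.1]
    · rw [Set.indicator_of_notMem hw]
      refine (lintegral_congr fun s => Set.indicator_of_notMem ?_ _).trans lintegral_zero
      rintro ⟨h1, h2, h3⟩
      exact hw ⟨h1, h2.trans h3⟩
  simp only [hl, hr] at key
  rwa [lintegral_indicator measurableSet_Ioo, lintegral_indicator measurableSet_Ioo] at key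

/-- The point `s` with `1 / s ^ 2 = cos² θ / S ^ 2 + sin² θ / w ^ 2`. -/
noncomputable def harmonicOrbit (w S θ : ℝ) : ℝ :=
  (√(1 / S ^ 2 + sin θ ^ 2 * (1 / w ^ 2 - 1 / S ^ 2)))⁻¹

lemma harmonicOrbit_radicand_pos {w S : ℝ} (hw : 0 < w) (hwS : w < S) (θ : ℝ) :
    0 < 1 / S ^ 2 + sin θ ^ 2 * (1 / w ^ 2 - 1 / S ^ 2) := by
  have hS : 0 < S := hw.trans hwS
  have h : 1 / S ^ 2 < 1 / w ^ 2 := by gcongr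
  have : 0 ≤ sin θ ^ 2 * (1 / w ^ 2 - 1 / S ^ 2) := mul_nonneg (sq_nonneg _) (by linarith)
  positivity

lemma harmonicOrbit_zero {w S : ℝ} (hS : 0 < S) : harmonicOrbit w S 0 = S := by
  simp [harmonicOrbit, Real.sqrt_sq hS.le]

lemma harmonicOrbit_pi_div_two {w S : ℝ} (hw : 0 < w) : harmonicOrbit w S (π / 2) = w := by
  simp [harmonicOrbit, Real.sqrt_sq hw.le]

lemma measurable_harmonicOrbit (w S : ℝ) : Measurable (harmonicOrbit w S) := by
  unfold harmonicOrbit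
  fun_prop

lemma continuous_harmonicOrbit {w S : ℝ} (hw : 0 < w) (hwS : w < S) :
    Continuous (harmonicOrbit w S) := by
  unfold harmonicOrbit
  refine Continuous.inv₀ (by fun_prop) fun θ => ?_
  exact (Real.sqrt_pos.2 (harmonicOrbit_radicand_pos hw hwS θ)).ne'

lemma strictAntiOn_harmonicOrbit {w S : ℝ} (hw : 0 < w) (hwS : w < S) :
    StrictAntiOn (harmonicOrbit w S) (Set.Icc 0 (π / 2)) := by
  intro x hx y hy hxy
  have h : 1 / S ^ 2 < 1 / w ^ 2 := by gcongr
  have h1 : sin x < sin y := strictMonoOn_sin ⟨by linarith [hx.1, pi_pos], hx.2⟩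
    ⟨by linarith [hy.1, pi_pos], hy.2⟩ hxy
  have h0 : 0 ≤ sin x := sin_nonneg_of_nonneg_of_le_pi hx.1 (by linarith [hx.2, pi_pos])
  have hs : sin x ^ 2 < sin y ^ 2 := by gcongr
  unfold harmonicOrbit
  have hp := harmonicOrbit_radicand_pos hw hwS x
  refine inv_strictAnti₀ (Real.sqrt_pos.2 hp) (Real.sqrt_lt_sqrt hp.le ?_)
  have := mul_lt_mul_of_pos_right hs (sub_pos.2 h)
  linarith

lemma harmonicOrbit_image {w S : ℝ} (hw : 0 < w) (hwS : w < S) :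
    harmonicOrbit w S '' Set.Ioo 0 (π / 2) = Set.Ioo w S := by
  have hpi : (0 : ℝ) ≤ π / 2 := by positivity
  apply Set.Subset.antisymm
  · rintro _ ⟨θ, hθ, rfl⟩
    have ha := strictAntiOn_harmonicOrbit hw hwS
    constructor
    · have := ha ⟨hθ.1.le, hθ.2.le⟩ ⟨hpi, le_rfl⟩ hθ.2
      rwa [harmonicOrbit_pi_div_two hw] at this
    · have := ha ⟨le_rfl, hpi⟩ ⟨hθ.1.le, hθ.2.le⟩ hθ.1
      rwa [harmonicOrbit_zero (hw.trans hwS)] at this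
  · have := intermediate_value_Ioo' hpi (continuous_harmonicOrbit hw hwS).continuousOn
    rwa [harmonicOrbit_pi_div_two hw, harmonicOrbit_zero (hw.trans hwS)] at this

lemma harmonicOrbit_lt_harmonicOrbit {w₁ w₂ S θ : ℝ} (h₁ : 0 < w₁) (h₁₂ : w₁ < w₂) (h₂ : w₂ < S)
    (hθ : θ ∈ Set.Ioo 0 (π / 2)) : harmonicOrbit w₁ S θ < harmonicOrbit w₂ S θ := by
  have hsin : 0 < sin θ := sin_pos_of_pos_of_lt_pi hθ.1 (by linarith [hθ.2, pi_pos])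
  have h : 1 / w₂ ^ 2 < 1 / w₁ ^ 2 := by gcongr
  have hp := harmonicOrbit_radicand_pos (h₁.trans h₁₂) h₂ θ
  unfold harmonicOrbit
  refine inv_strictAnti₀ (Real.sqrt_pos.2 hp) (Real.sqrt_lt_sqrt hp.le ?_)
  have := mul_lt_mul_of_pos_left h (pow_pos hsin 2)
  linarith

lemma hasDerivAt_harmonicOrbit {w S : ℝ} (hw : 0 < w) (hwS : w < S) (θ : ℝ) :
    HasDerivAt (harmonicOrbit w S)
      (-(harmonicOrbit w S θ ^ 3 * (sin θ * cos θ * (1 / w ^ 2 - 1 / S ^ 2)))) θ := by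
  have hp := harmonicOrbit_radicand_pos hw hwS θ
  have h1 : HasDerivAt (fun θ => 1 / S ^ 2 + sin θ ^ 2 * (1 / w ^ 2 - 1 / S ^ 2))
      (2 * sin θ * cos θ * (1 / w ^ 2 - 1 / S ^ 2)) θ := by
    have := (((hasDerivAt_sin θ).fun_pow 2).mul_const (1 / w ^ 2 - 1 / S ^ 2)).const_add (1 / S ^ 2)
    simpa using this
  have h2 := (h1.sqrt hp.ne').fun_inv (Real.sqrt_pos.2 hp).ne'
  refine h2.congr_deriv ?_
  have hq := Real.sqrt_pos.2 hp
  unfold harmonicOrbit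
  generalize √(1 / S ^ 2 + sin θ ^ 2 * (1 / w ^ 2 - 1 / S ^ 2)) = q at hq ⊢
  generalize 1 / w ^ 2 - 1 / S ^ 2 = L
  field_simp

/-- The substitution `s = harmonicOrbit w S θ` removes the singularity at `s = w`. -/
lemma abs_deriv_harmonicOrbit_mul {w S θ : ℝ} (hw : 0 < w) (hwS : w < S)
    (hθ : θ ∈ Set.Ioo 0 (π / 2)) :
    |-(harmonicOrbit w S θ ^ 3 * (sin θ * cos θ * (1 / w ^ 2 - 1 / S ^ 2)))| *
        (w / (harmonicOrbit w S θ * √(harmonicOrbit w S θ ^ 2 - w ^ 2))) =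
      √(S ^ 2 - harmonicOrbit w S θ ^ 2) / S := by
  have hS : 0 < S := hw.trans hwS
  have hsin : 0 < sin θ := sin_pos_of_pos_of_lt_pi hθ.1 (by linarith [hθ.2, pi_pos])
  have hcos : 0 < cos θ := cos_pos_of_mem_Ioo ⟨by linarith [hθ.1, pi_pos], hθ.2⟩
  have hL : 0 < 1 / w ^ 2 - 1 / S ^ 2 := by
    have : 1 / S ^ 2 < 1 / w ^ 2 := by gcongr
    linarith
  have hp := harmonicOrbit_radicand_pos hw hwS θ
  have hs : 0 < harmonicOrbit w S θ := inv_pos.2 (Real.sqrt_pos.2 hp)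
  have hsq : harmonicOrbit w S θ ^ 2 * (1 / S ^ 2 + sin θ ^ 2 * (1 / w ^ 2 - 1 / S ^ 2)) = 1 := by
    unfold harmonicOrbit
    rw [inv_pow, Real.sq_sqrt hp.le, inv_mul_cancel₀ hp.ne']
  generalize harmonicOrbit w S θ = s at hs hsq ⊢
  set L := 1 / w ^ 2 - 1 / S ^ 2 with hLdef
  have hl := Real.sqrt_pos.2 hL
  have hll := Real.mul_self_sqrt hL.le
  have h1 : √(s ^ 2 - w ^ 2) = s * w * √L * cos θ := by
    rw [Real.sqrt_eq_iff_mul_self_eq_of_pos (by positivity)]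
    have e1 : w ^ 2 * (1 / S ^ 2) = 1 - w ^ 2 * L := by rw [hLdef]; field_simp; ring
    have e3 := sin_sq_add_cos_sq θ
    calc s * w * √L * cos θ * (s * w * √L * cos θ)
        = s ^ 2 * w ^ 2 * (√L * √L) * cos θ ^ 2 := by ring
      _ = s ^ 2 * (1 - w ^ 2 * (1 / S ^ 2)) - w ^ 2 * (s ^ 2 * (sin θ ^ 2 * L)) := by
        rw [hll, e1]
        rw [show cos θ ^ 2 = 1 - sin θ ^ 2 by linarith]; ring
      _ = s ^ 2 - w ^ 2 * (s ^ 2 * (1 / S ^ 2 + sin θ ^ 2 * L)) := by ring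
      _ = s ^ 2 - w ^ 2 := by rw [hsq]; ring
  have h2 : √(S ^ 2 - s ^ 2) = s * S * √L * sin θ := by
    rw [Real.sqrt_eq_iff_mul_self_eq_of_pos (by positivity)]
    calc s * S * √L * sin θ * (s * S * √L * sin θ)
        = S ^ 2 * (s ^ 2 * (sin θ ^ 2 * (√L * √L))) := by ring
      _ = S ^ 2 * (s ^ 2 * (1 / S ^ 2 + sin θ ^ 2 * L)) - s ^ 2 := by
        rw [hll]; field_simp; ring
      _ = S ^ 2 - s ^ 2 := by rw [hsq]; ring
  rw [h1, h2, abs_neg, abs_of_pos (by positivity)]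
  nth_rewrite 1 [← hll]
  field_simp

lemma lintegral_comp_harmonicOrbit {w S : ℝ} (hw : 0 < w) (hwS : w < S) (K : ℝ → ENNReal) :
    ∫⁻ s in Set.Ioo w S, ENNReal.ofReal (w / (s * √(s ^ 2 - w ^ 2))) * K s =
      ∫⁻ θ in Set.Ioo 0 (π / 2), ENNReal.ofReal (√(S ^ 2 - harmonicOrbit w S θ ^ 2) / S) *
        K (harmonicOrbit w S θ) := by
  rw [← harmonicOrbit_image hw hwS, lintegral_image_eq_lintegral_abs_deriv_mul measurableSet_Ioo
    (fun θ _ => (hasDerivAt_harmonicOrbit hw hwS θ).hasDerivWithinAt)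
    ((strictAntiOn_harmonicOrbit hw hwS).injOn.mono Set.Ioo_subset_Icc_self)]
  refine setLIntegral_congr_fun measurableSet_Ioo fun θ hθ => ?_
  rw [← mul_assoc, ← ENNReal.ofReal_mul (abs_nonneg _), abs_deriv_harmonicOrbit_mul hw hwS hθ]

/-- The factor comparing the potential for the exponent `p` with the one for exponent `2`. -/
noncomputable def harmonicRatio (p s : ℝ) : ℝ :=
  √(((1 / 4 : ℝ) ^ (1 / p)) ^ 2 - s ^ 2) / √(1 / 4 - s ^ p)

lemma harmonicRatio_nonneg (p s : ℝ) : 0 ≤ harmonicRatio p s :=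
  div_nonneg (Real.sqrt_nonneg _) (Real.sqrt_nonneg _)

lemma measurable_harmonicRatio (p : ℝ) : Measurable (harmonicRatio p) := by
  unfold harmonicRatio
  fun_prop

lemma harmonicRatio_eq_sqrt_div {p s : ℝ} (hp : 0 < p) (hs : 0 < s)
    (hsS : s < (1 / 4 : ℝ) ^ (1 / p)) :
    harmonicRatio p s = √((((1 / 4 : ℝ) ^ (1 / p)) ^ 2 - s ^ 2) / (1 / 4 - s ^ p)) := by
  have := rpow_lt_quarter hp hs.le hsS
  rw [harmonicRatio, Real.sqrt_div' _ (by linarith)]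

lemma harmonicRatio_strictMonoOn {p : ℝ} (hp : 0 < p) (hp2 : p < 2) :
    StrictMonoOn (harmonicRatio p) (Set.Ioo 0 ((1 / 4 : ℝ) ^ (1 / p))) := by
  intro x hx y hy hxy
  rw [harmonicRatio_eq_sqrt_div hp hx.1 hx.2, harmonicRatio_eq_sqrt_div hp hy.1 hy.2]
  have hxq := rpow_lt_quarter hp hx.1.le hx.2
  have hyq := rpow_lt_quarter hp hy.1.le hy.2
  have hxx : x ^ 2 < ((1 / 4 : ℝ) ^ (1 / p)) ^ 2 := pow_lt_pow_left₀ hx.2 hx.1.le two_ne_zero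
  have hsq : ∀ z : ℝ, 0 < z → (z ^ p) ^ (2 / p) = z ^ 2 := fun z hz => by
    rw [← Real.rpow_mul hz.le, mul_div_cancel₀ _ hp.ne', Real.rpow_two]
  have hS : 0 < (1 / 4 : ℝ) ^ (1 / p) := by positivity
  have h := (strictConvexOn_rpow ((one_lt_div hp).2 hp2)).secant_strict_mono
    (a := 1 / 4) (x := x ^ p) (y := y ^ p) (by norm_num [Set.mem_Ici])
    (Real.rpow_nonneg hx.1.le _) (Real.rpow_nonneg hy.1.le _) hxq.ne hyq.ne
    (Real.rpow_lt_rpow hx.1.le hxy hp)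
  have hq : (1 / 4 : ℝ) ^ (2 / p) = ((1 / 4 : ℝ) ^ (1 / p)) ^ 2 := by
    rw [← hsq _ hS, quarter_rpow_rpow hp]
  simp only [hsq x hx.1, hsq y hy.1, hq] at h
  rw [← neg_sub, ← neg_sub (1 / 4 : ℝ), neg_div_neg_eq, ← neg_sub _ (y ^ 2),
    ← neg_sub (1 / 4 : ℝ), neg_div_neg_eq] at h
  exact Real.sqrt_lt_sqrt (div_nonneg (by linarith) (by linarith)) h

lemma harmonicRatio_le {p s : ℝ} (hp : 1 ≤ p) (hs : 0 < s) (hsS : s < (1 / 4 : ℝ) ^ (1 / p)) :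
    harmonicRatio p s ≤ √(8 * ((1 / 4 : ℝ) ^ (1 / p)) ^ 2) := by
  have hp0 : 0 < p := by linarith
  rw [harmonicRatio_eq_sqrt_div hp0 hs hsS]
  have hq := rpow_lt_quarter hp0 hs.le hsS
  have hSp := quarter_rpow_rpow hp0
  set S := (1 / 4 : ℝ) ^ (1 / p)
  have hS : 0 < S := by positivity
  have h1 : (s / S) ^ p ≤ (s / S) ^ (1 : ℝ) :=
    Real.rpow_le_rpow_of_exponent_ge (by positivity) ((div_le_one hS).2 hsS.le) hp
  rw [Real.rpow_one, Real.div_rpow hs.le hS.le, hSp, div_le_div_iff₀ (by norm_num) hS] at h1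
  refine Real.sqrt_le_sqrt ((div_le_iff₀ (by linarith)).2 ?_)
  nlinarith [mul_pos hS hS, mul_pos hS hs, mul_nonneg hS.le (sub_nonneg.2 h1)]

/-- The opposite of the derivative of `g p` at `w`, as an integral without singularities. -/
noncomputable def gSlope (p w : ℝ) : ℝ :=
  ∫ θ in (0 : ℝ)..π / 2,
    harmonicRatio p (harmonicOrbit w ((1 / 4 : ℝ) ^ (1 / p)) θ) / (1 / 4 : ℝ) ^ (1 / p)

lemma harmonicOrbit_mem_Ioo {w S θ : ℝ} (hw : 0 < w) (hwS : w < S)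
    (hθ : θ ∈ Set.Ioo 0 (π / 2)) : harmonicOrbit w S θ ∈ Set.Ioo 0 S := by
  have := harmonicOrbit_image hw hwS ▸ Set.mem_image_of_mem (harmonicOrbit w S) hθ
  exact ⟨hw.trans this.1, this.2⟩

lemma integrableOn_gSlope_integrand {p w : ℝ} (hp : 1 ≤ p) (hw : 0 < w)
    (hwS : w < (1 / 4 : ℝ) ^ (1 / p)) :
    IntegrableOn (fun θ => harmonicRatio p (harmonicOrbit w ((1 / 4 : ℝ) ^ (1 / p)) θ) /
      (1 / 4 : ℝ) ^ (1 / p)) (Set.Ioo 0 (π / 2)) := by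
  have hmeas := (((measurable_harmonicRatio p).comp
    (measurable_harmonicOrbit w ((1 / 4 : ℝ) ^ (1 / p)))).div_const ((1 / 4 : ℝ) ^ (1 / p)))
  refine Measure.integrableOn_of_bounded (M := √(8 * ((1 / 4 : ℝ) ^ (1 / p)) ^ 2) /
    (1 / 4 : ℝ) ^ (1 / p)) (by simp) hmeas.aestronglyMeasurable ?_
  refine (ae_restrict_iff' measurableSet_Ioo).2 (Filter.Eventually.of_forall fun θ hθ => ?_)
  have hmem := harmonicOrbit_mem_Ioo hw hwS hθ
  rw [Real.norm_of_nonneg (div_nonneg (harmonicRatio_nonneg _ _) (by positivity))]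
  gcongr
  exact harmonicRatio_le hp hmem.1 hmem.2

lemma intervalIntegrable_gSlope_integrand {p w : ℝ} (hp : 1 ≤ p) (hw : 0 < w)
    (hwS : w < (1 / 4 : ℝ) ^ (1 / p)) :
    IntervalIntegrable (fun θ => harmonicRatio p (harmonicOrbit w ((1 / 4 : ℝ) ^ (1 / p)) θ) /
      (1 / 4 : ℝ) ^ (1 / p)) volume 0 (π / 2) :=
  (intervalIntegrable_iff_integrableOn_Ioo_of_le (by positivity)).2
    (integrableOn_gSlope_integrand hp hw hwS)

lemma gSlope_strictMonoOn {p : ℝ} (hp1 : 1 < p) (hp2 : p < 2) :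
    StrictMonoOn (gSlope p) (Set.Ioo 0 ((1 / 4 : ℝ) ^ (1 / p))) := by
  intro x hx y hy hxy
  have hix := intervalIntegrable_gSlope_integrand hp1.le hx.1 hx.2
  have hiy := intervalIntegrable_gSlope_integrand hp1.le hy.1 hy.2
  rw [← sub_pos, gSlope, gSlope, ← intervalIntegral.integral_sub hiy hix]
  refine intervalIntegral.intervalIntegral_pos_of_pos_on (hiy.sub hix) (fun θ hθ => ?_)
    (by positivity)
  rw [sub_pos]
  gcongr
  exact harmonicRatio_strictMonoOn (by linarith) hp2 (harmonicOrbit_mem_Ioo hx.1 hx.2 hθ)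
    (harmonicOrbit_mem_Ioo hy.1 hy.2 hθ) (harmonicOrbit_lt_harmonicOrbit hx.1 hxy hy.2 hθ)

lemma ofReal_gSlope {p w : ℝ} (hp : 1 ≤ p) (hw : 0 < w) (hwS : w < (1 / 4 : ℝ) ^ (1 / p)) :
    ENNReal.ofReal (gSlope p w) = ∫⁻ s in Set.Ioo w ((1 / 4 : ℝ) ^ (1 / p)),
      ENNReal.ofReal (w / (s * √(s ^ 2 - w ^ 2))) * ENNReal.ofReal (1 / √(1 / 4 - s ^ p)) := by
  rw [lintegral_comp_harmonicOrbit hw hwS fun s => ENNReal.ofReal (1 / √(1 / 4 - s ^ p)), gSlope,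
    intervalIntegral.integral_of_le (by positivity), integral_Ioc_eq_integral_Ioo,
    ofReal_integral_eq_lintegral_ofReal (integrableOn_gSlope_integrand hp hw hwS)
      (Filter.Eventually.of_forall fun θ => div_nonneg (harmonicRatio_nonneg _ _) (by positivity))]
  refine lintegral_congr fun θ => ?_
  rw [← ENNReal.ofReal_mul (by positivity), harmonicRatio]
  congr 1
  ring

lemma lintegral_eq_lintegral_gSlope {p a : ℝ} (hp : 1 ≤ p) (ha : 0 < a) :
    ∫⁻ s in Set.Ioo a ((1 / 4 : ℝ) ^ (1 / p)),
        ENNReal.ofReal (√(s ^ 2 - a ^ 2) / (s * √(1 / 4 - s ^ p))) =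
      ∫⁻ w in Set.Ioo a ((1 / 4 : ℝ) ^ (1 / p)), ENNReal.ofReal (gSlope p w) := by
  rw [setLIntegral_congr_fun measurableSet_Ioo fun w hw =>
      ofReal_gSlope hp (ha.trans hw.1) hw.2,
    ← lintegral_triangle_swap (F := fun s w => ENNReal.ofReal (w / (s * √(s ^ 2 - w ^ 2))) *
      ENNReal.ofReal (1 / √(1 / 4 - s ^ p))) (by unfold Function.uncurry; fun_prop)]
  refine setLIntegral_congr_fun measurableSet_Ioo fun s hs => ?_
  have hs0 : 0 < s := ha.trans hs.1
  have h : ∀ w, ENNReal.ofReal (w / (s * √(s ^ 2 - w ^ 2))) * ENNReal.ofReal (1 / √(1 / 4 - s ^ p))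
      = ENNReal.ofReal (1 / (s * √(1 / 4 - s ^ p))) * ENNReal.ofReal (w / √(s ^ 2 - w ^ 2)) := by
    intro w
    rw [← ENNReal.ofReal_mul' (by positivity), ← ENNReal.ofReal_mul (by positivity)]
    congr 1
    field_simp
  simp only [h]
  rw [lintegral_const_mul _ (by fun_prop), ← ofReal_sqrt_sq_sub_sq ha hs.1,
    ← ENNReal.ofReal_mul (by positivity)]
  congr 1
  ring

lemma gSlope_nonneg (p w : ℝ) : 0 ≤ gSlope p w :=
  intervalIntegral.integral_nonneg (by positivity) fun _ _ =>
    div_nonneg (harmonicRatio_nonneg _ _) (by positivity)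

lemma gSlope_le {p w : ℝ} (hp : 1 ≤ p) (hw : 0 < w) (hwS : w < (1 / 4 : ℝ) ^ (1 / p)) :
    gSlope p w ≤ √(8 * ((1 / 4 : ℝ) ^ (1 / p)) ^ 2) / (1 / 4 : ℝ) ^ (1 / p) * (π / 2) := by
  have h := intervalIntegral.integral_mono_on_of_le_Ioo (by positivity)
    (intervalIntegrable_gSlope_integrand hp hw hwS)
    (intervalIntegrable_const (c := √(8 * ((1 / 4 : ℝ) ^ (1 / p)) ^ 2) / (1 / 4 : ℝ) ^ (1 / p)))
    fun θ hθ => by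
      have hmem := harmonicOrbit_mem_Ioo hw hwS hθ
      gcongr
      exact harmonicRatio_le hp hmem.1 hmem.2
  rw [intervalIntegral.integral_const, smul_eq_mul, sub_zero, mul_comm] at h
  exact h

lemma integrableOn_gSlope {p a : ℝ} (hp1 : 1 < p) (hp2 : p < 2) (ha : 0 < a) :
    IntegrableOn (gSlope p) (Set.Ioo a ((1 / 4 : ℝ) ^ (1 / p))) := by
  have hmeas : AEStronglyMeasurable (gSlope p)
      (volume.restrict (Set.Ioo a ((1 / 4 : ℝ) ^ (1 / p)))) :=
    (aemeasurable_restrict_of_monotoneOn measurableSet_Ioo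
      ((gSlope_strictMonoOn hp1 hp2).monotoneOn.mono
        (Set.Ioo_subset_Ioo_left ha.le))).aestronglyMeasurable
  refine Integrable.of_bound hmeas
    (√(8 * ((1 / 4 : ℝ) ^ (1 / p)) ^ 2) / (1 / 4 : ℝ) ^ (1 / p) * (π / 2)) ?_
  refine (ae_restrict_iff' measurableSet_Ioo).2 (Filter.Eventually.of_forall fun w hw => ?_)
  rw [Real.norm_of_nonneg (gSlope_nonneg _ _)]
  exact gSlope_le hp1.le (ha.trans hw.1) hw.2

lemma g_eq_integral_gSlope {p a : ℝ} (hp1 : 1 < p) (hp2 : p < 2) (ha : 0 < a)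
    (haS : a < (1 / 4 : ℝ) ^ (1 / p)) :
    g p a = ∫ w in a..(1 / 4 : ℝ) ^ (1 / p), gSlope p w := by
  rw [g_eq_toReal_lintegral (by linarith) ha haS, lintegral_eq_lintegral_gSlope hp1.le ha,
    intervalIntegral.integral_of_le haS.le, integral_Ioc_eq_integral_Ioo,
    integral_eq_lintegral_of_nonneg_ae (Filter.Eventually.of_forall (gSlope_nonneg p))
      (integrableOn_gSlope hp1 hp2 ha).aestronglyMeasurable]

lemma g_sub_g {p a b : ℝ} (hp1 : 1 < p) (hp2 : p < 2) (ha : 0 < a) (hab : a ≤ b)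
    (hbS : b < (1 / 4 : ℝ) ^ (1 / p)) : g p a - g p b = ∫ w in a..b, gSlope p w := by
  have hi : ∀ c, 0 < c → c < (1 / 4 : ℝ) ^ (1 / p) →
      IntervalIntegrable (gSlope p) volume c ((1 / 4 : ℝ) ^ (1 / p)) := fun c hc hcS =>
    (intervalIntegrable_iff_integrableOn_Ioo_of_le hcS.le).2 (integrableOn_gSlope hp1 hp2 hc)
  rw [g_eq_integral_gSlope hp1 hp2 ha (hab.trans_lt hbS),
    g_eq_integral_gSlope hp1 hp2 (ha.trans_le hab) hbS]
  rw [← intervalIntegral.integral_add_adjacent_intervals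
    ((hi a ha (hab.trans_lt hbS)).trans (hi b (ha.trans_le hab) hbS).symm)
    (hi b (ha.trans_le hab) hbS), add_sub_cancel_right]

lemma g_sub_g_bounds {p a b : ℝ} (hp1 : 1 < p) (hp2 : p < 2) (ha : 0 < a) (hab : a ≤ b)
    (hbS : b < (1 / 4 : ℝ) ^ (1 / p)) :
    (b - a) * gSlope p a ≤ g p a - g p b ∧ g p a - g p b ≤ (b - a) * gSlope p b := by
  have hsub : Set.Icc a b ⊆ Set.Ioo 0 ((1 / 4 : ℝ) ^ (1 / p)) := fun x hx =>
    ⟨ha.trans_le hx.1, hx.2.trans_lt hbS⟩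
  have hmono := (gSlope_strictMonoOn hp1 hp2).monotoneOn.mono hsub
  have hi : IntervalIntegrable (gSlope p) volume a b :=
    MonotoneOn.intervalIntegrable (by rwa [Set.uIcc_of_le hab])
  rw [g_sub_g hp1 hp2 ha hab hbS]
  constructor
  · simpa using intervalIntegral.integral_mono_on hab intervalIntegrable_const hi
      fun x hx => hmono ⟨le_rfl, hab⟩ hx hx.1
  · simpa using intervalIntegral.integral_mono_on hab hi intervalIntegrable_const
      fun x hx => hmono hx ⟨hab, le_rfl⟩ hx.2

/-- for `1 < p < 2`, `g_p` is strictly concave on `(0, (1/4)^(1/p))`. -/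
theorem g_strictConcaveOn (p : ℝ) (hp1 : 1 < p) (hp2 : p < 2) :
    StrictConcaveOn ℝ (Set.Ioo (0 : ℝ) ((1 / 4 : ℝ) ^ (1 / p))) (g p) := by
  refine strictConcaveOn_of_slope_strict_anti_adjacent (convex_Ioo _ _) ?_
  intro x y z hx hz hxy hyz
  have hyS := hyz.trans hz.2
  have hy0 := hx.1.trans hxy
  obtain ⟨m, hxm, hmy⟩ := exists_between hxy
  have hm0 := hx.1.trans hxm
  have h1 := (g_sub_g_bounds hp1 hp2 hx.1 hxm.le (hmy.trans hyS)).2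
  have h2 := (g_sub_g_bounds hp1 hp2 hm0 hmy.le hyS).2
  have h3 := (g_sub_g_bounds hp1 hp2 hy0 hyz.le hz.2).1
  have hlt := gSlope_strictMonoOn hp1 hp2 ⟨hm0, hmy.trans hyS⟩ ⟨hy0, hyS⟩ hmy
  have h4 := mul_lt_mul_of_pos_left hlt (sub_pos.2 hxm)
  calc (g p z - g p y) / (z - y) ≤ -gSlope p y := by
        rw [div_le_iff₀ (by linarith)]; linarith
    _ < (g p y - g p x) / (y - x) := by
        rw [lt_div_iff₀ (by linarith)]; linarith
end

section
/- For every real p > 2, the function g_p is strictly convex on the interval (0, (1/4)^(1/p)). -/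
open Real

open MeasureTheory Set

/-- The square of `r (1 - r ^ p) ^ (1 / p)` in the coordinate `y = r ^ p - 1 / 2`. -/
noncomputable def profile (p y : ℝ) : ℝ := (1 / 4 - y ^ 2) ^ (2 / p)

/-- The half-width of the domain of integration of `g p v` in the coordinate `y = r ^ p - 1 / 2`. -/
noncomputable def halfWidth (p v : ℝ) : ℝ := Real.sqrt (1 / 4 - v ^ p)

lemma halfWidth_nonneg (p v : ℝ) : 0 ≤ halfWidth p v := Real.sqrt_nonneg _

lemma halfWidth_lt {p v : ℝ} (hv : 0 < v) : halfWidth p v < 1 / 2 := by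
  rw [halfWidth, Real.sqrt_lt' (by norm_num)]
  have := Real.rpow_pos_of_pos hv p
  linarith

lemma profile_le_sq_iff {p v y : ℝ} (hp : 0 < p) (hv : 0 < v) (hy : 0 ≤ y) (hy' : y < 1 / 2) :
    profile p y ≤ v ^ 2 ↔ halfWidth p v ≤ y := by
  have h1 : v ^ 2 = (v ^ p) ^ (2 / p) := by
    rw [← Real.rpow_mul hv.le, mul_div_cancel₀ _ hp.ne']
    norm_num
  rw [profile, h1, Real.rpow_le_rpow_iff (by nlinarith) (Real.rpow_pos_of_pos hv p).le
    (by positivity), halfWidth, Real.sqrt_le_left hy]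
  constructor <;> intro h <;> linarith

lemma continuous_profile {p : ℝ} (hp : 0 < p) : Continuous (profile p) :=
  Continuous.rpow_const (by fun_prop) fun _ => Or.inr (by positivity)

lemma integrand_eq_profile {p v y : ℝ} (hy : y ∈ Ioo (-(1 / 2) : ℝ) (1 / 2)) (hp : 0 < p) :
    Real.sqrt ((1 - ((1 / 2 + y) ^ (1 / p)) ^ p) ^ (2 / p) - v ^ 2 / ((1 / 2 + y) ^ (1 / p)) ^ 2) *
      (1 / p * (1 / 2 + y) ^ (1 / p - 1)) =
    1 / p * (Real.sqrt (profile p y - v ^ 2) / (1 / 2 + y)) := by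
  have hx : 0 < 1 / 2 + y := by linarith [hy.1]
  have hx' : 0 < 1 / 2 - y := by linarith [hy.2]
  have hu : 0 < (1 / 2 + y) ^ (1 / p) := Real.rpow_pos_of_pos hx _
  have h1 : ((1 / 2 + y) ^ (1 / p)) ^ p = 1 / 2 + y := by
    rw [← Real.rpow_mul hx.le, one_div_mul_cancel hp.ne', Real.rpow_one]
  have h2 : profile p y = (1 / 2 - y) ^ (2 / p) * ((1 / 2 + y) ^ (1 / p)) ^ 2 := by
    rw [profile, ← Real.rpow_mul_natCast hx.le, show 1 / p * ((2 : ℕ) : ℝ) = 2 / p by push_cast; ring,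
      ← Real.mul_rpow hx'.le hx.le]
    ring_nf
  rw [h1, h2, Real.rpow_sub hx, Real.rpow_one, show 1 - (1 / 2 + y) = 1 / 2 - y by ring]
  set u := (1 / 2 + y) ^ (1 / p)
  have h3 : (1 / 2 - y) ^ (2 / p) * u ^ 2 - v ^ 2 =
      ((1 / 2 - y) ^ (2 / p) - v ^ 2 / u ^ 2) * u ^ 2 := by
    field_simp
  rw [h3, Real.sqrt_mul' _ (sq_nonneg u), Real.sqrt_sq hu.le]
  ring

lemma integral_eq_profile {p v : ℝ} (hp : 0 < p) (hv : 0 < v) :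
    ∫ r in rMinus p v..rPlus p v, Real.sqrt ((1 - r ^ p) ^ (2 / p) - v ^ 2 / r ^ 2) =
    ∫ y in -halfWidth p v..halfWidth p v,
      1 / p * (Real.sqrt (profile p y - v ^ 2) / (1 / 2 + y)) := by
  have hS0 := halfWidth_nonneg p v
  have hS := halfWidth_lt (p := p) hv
  have hI : uIcc (-halfWidth p v) (halfWidth p v) = Icc (-halfWidth p v) (halfWidth p v) :=
    uIcc_of_le (by linarith)
  have hpos : ∀ y ∈ Icc (-halfWidth p v) (halfWidth p v), 0 < 1 / 2 + y := fun y hy => by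
    linarith [hy.1]
  have hm : rMinus p v = (1 / 2 + -halfWidth p v) ^ (1 / p) := by
    rw [rMinus, halfWidth, sub_eq_add_neg]
  have hM : rPlus p v = (1 / 2 + halfWidth p v) ^ (1 / p) := rfl
  rw [hm, hM, ← intervalIntegral.integral_comp_mul_deriv'' (f := fun y => (1 / 2 + y) ^ (1 / p))
    (f' := fun y => 1 / p * (1 / 2 + y) ^ (1 / p - 1))
    (g := fun r => Real.sqrt ((1 - r ^ p) ^ (2 / p) - v ^ 2 / r ^ 2))]
  · refine intervalIntegral.integral_congr fun y hy => ?_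
    rw [hI] at hy
    exact integrand_eq_profile ⟨by linarith [hy.1], by linarith [hy.2]⟩ hp
  · rw [hI]
    exact ContinuousOn.rpow_const (by fun_prop) fun y hy => Or.inl (hpos y hy).ne'
  · intro y hy
    rw [min_eq_left (by linarith), max_eq_right (by linarith)] at hy
    have := ((hasDerivAt_id y).const_add (1 / 2)).rpow_const (p := 1 / p)
      (Or.inl (hpos y (Ioo_subset_Icc_self hy)).ne')
    simpa using this.hasDerivWithinAt
  · rw [hI]
    exact continuousOn_const.mul
      (ContinuousOn.rpow_const (by fun_prop) fun y hy => Or.inl (hpos y hy).ne')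
  · rw [hI]
    have hr : ∀ r ∈ (fun y : ℝ => (1 / 2 + y) ^ (1 / p)) '' Icc (-halfWidth p v) (halfWidth p v),
        r ≠ 0 := by
      rintro _ ⟨y, hy, rfl⟩
      exact (Real.rpow_pos_of_pos (hpos y hy) _).ne'
    refine ContinuousOn.sqrt (ContinuousOn.sub ?_ ?_)
    · refine ContinuousOn.rpow_const (continuousOn_const.sub ?_) fun _ _ => Or.inr (by positivity)
      exact ContinuousOn.rpow_const continuousOn_id fun r h => Or.inl (hr r h)
    · exact continuousOn_const.div (by fun_prop) fun r h => pow_ne_zero 2 (hr r h)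

lemma g_eq_integral_profile {p v : ℝ} (hp : 0 < p) (hv : 0 < v) :
    g p v = ∫ y in (0 : ℝ)..halfWidth p v,
      2 / p * (Real.sqrt (profile p y - v ^ 2) / (1 / 4 - y ^ 2)) := by
  have hS0 := halfWidth_nonneg p v
  have hS := halfWidth_lt (p := p) hv
  set S := halfWidth p v
  set F : ℝ → ℝ := fun y => 1 / p * (Real.sqrt (profile p y - v ^ 2) / (1 / 2 + y)) with hF
  have hc : ContinuousOn F (Icc (-S) S) := by
    refine continuousOn_const.mul (ContinuousOn.div ?_ (by fun_prop) fun y hy => ?_)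
    · exact (((continuous_profile hp).sub continuous_const).sqrt).continuousOn
    · have := hy.1
      intro h
      linarith
  have i1 : IntervalIntegrable F volume (-S) 0 :=
    (hc.mono (Icc_subset_Icc le_rfl hS0)).intervalIntegrable_of_Icc (by linarith)
  have i2 : IntervalIntegrable F volume 0 S :=
    (hc.mono (Icc_subset_Icc (by linarith) le_rfl)).intervalIntegrable_of_Icc hS0
  have i3 : IntervalIntegrable (fun y => F (-y)) volume 0 S := by
    refine ContinuousOn.intervalIntegrable_of_Icc hS0 (hc.comp (by fun_prop) fun y hy => ?_)
    exact ⟨by linarith [hy.2], by linarith [hy.1]⟩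
  rw [g, integral_eq_profile hp hv, ← intervalIntegral.integral_add_adjacent_intervals i1 i2]
  have h := intervalIntegral.integral_comp_neg (a := 0) (b := S) F
  rw [neg_zero] at h
  rw [← h, ← intervalIntegral.integral_add i3 i2, ← intervalIntegral.integral_const_mul]
  refine intervalIntegral.integral_congr fun y hy => ?_
  rw [uIcc_of_le hS0] at hy
  have h1 : 1 / 2 + y ≠ 0 := by linarith [hy.1]
  have h2 : 1 / 2 - y ≠ 0 := by linarith [hy.2]
  have h3 : 1 / 4 - y ^ 2 = (1 / 2 + y) * (1 / 2 - y) := by ring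
  have h4 : profile p (-y) = profile p y := by simp [profile]
  have h5 : Real.sqrt (profile p y - v ^ 2) / (1 / 4 - y ^ 2) =
      Real.sqrt (profile p y - v ^ 2) / (1 / 2 - y) +
        Real.sqrt (profile p y - v ^ 2) / (1 / 2 + y) := by
    rw [h3, div_add_div _ _ h2 h1, mul_comm (1 / 2 + y)]
    congr 1
    ring
  simp only [hF, h4, h5, ← sub_eq_add_neg]
  ring

lemma setLIntegral_eq_of_eq_zero_on_diff {s t : Set ℝ} (hs : MeasurableSet s) (ht : MeasurableSet t)
    (hst : s ⊆ t) {f : ℝ → ENNReal} (h : ∀ x ∈ t \ s, f x = 0) :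
    ∫⁻ x in s, f x = ∫⁻ x in t, f x := by
  rw [← lintegral_inter_add_sdiff f t hs, inter_eq_self_of_subset_right hst,
    setLIntegral_congr_fun (ht.diff hs) h, lintegral_zero, add_zero]

lemma ofReal_intervalIntegral {f : ℝ → ℝ} {a b : ℝ} (hab : a ≤ b)
    (hf : IntervalIntegrable f volume a b) (h0 : ∀ x ∈ Ioo a b, 0 ≤ f x) :
    ENNReal.ofReal (∫ x in a..b, f x) = ∫⁻ x in Ioo a b, ENNReal.ofReal (f x) := by
  rw [intervalIntegral.integral_of_le hab, integral_Ioc_eq_integral_Ioo,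
    ofReal_integral_eq_lintegral_ofReal]
  · exact ((intervalIntegrable_iff_integrableOn_Ioo_of_le hab).1 hf)
  · exact (ae_restrict_iff' measurableSet_Ioo).2 (Filter.Eventually.of_forall h0)

lemma ofReal_sqrt_sub_sq {v m P : ℝ} (hv : 0 < v) (hm : 0 < m) (hPm : P ≤ m ^ 2) :
    ENNReal.ofReal (Real.sqrt (P - v ^ 2)) =
      ∫⁻ w in Ioo v m, ENNReal.ofReal (w / Real.sqrt (P - w ^ 2)) := by
  have key : ∀ w, P ≤ w ^ 2 → ENNReal.ofReal (w / Real.sqrt (P - w ^ 2)) = 0 := by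
    intro w h
    rw [Real.sqrt_eq_zero'.2 (by linarith), div_zero, ENNReal.ofReal_zero]
  rcases le_or_gt P (v ^ 2) with hP | hP
  · rw [Real.sqrt_eq_zero'.2 (by linarith), ENNReal.ofReal_zero,
      setLIntegral_congr_fun measurableSet_Ioo (g := fun _ => 0), lintegral_zero]
    intro w hw
    exact key w (hP.trans (by nlinarith [hw.1]))
  · have hP0 : 0 < P := lt_of_le_of_lt (sq_nonneg v) hP
    set A := Real.sqrt P
    have hA : A ^ 2 = P := Real.sq_sqrt hP0.le
    have hA0 : 0 ≤ A := Real.sqrt_nonneg P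
    have hvA : v < A := lt_of_pow_lt_pow_left₀ 2 hA0 (by rwa [hA])
    have hAm : A ≤ m := le_of_sq_le_sq (by rwa [hA]) hm.le
    rw [← setLIntegral_eq_of_eq_zero_on_diff (s := Ioo v A) measurableSet_Ioo measurableSet_Ioo
      (Ioo_subset_Ioo_right hAm)]
    · have hcont : ContinuousOn (fun w => -Real.sqrt (P - w ^ 2)) (Icc v A) := by fun_prop
      have hder : ∀ w ∈ Ioo v A, HasDerivAt (fun w => -Real.sqrt (P - w ^ 2))
          (w / Real.sqrt (P - w ^ 2)) w := by
        intro w hw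
        have h1 : P - w ^ 2 ≠ 0 := by nlinarith [hw.1, hw.2]
        refine (((hasDerivAt_pow 2 w).const_sub P).sqrt h1).neg.congr_deriv ?_
        push_cast
        ring
      have hnn : ∀ w ∈ Ioo v A, 0 ≤ w / Real.sqrt (P - w ^ 2) := fun w hw =>
        div_nonneg (hv.trans hw.1).le (Real.sqrt_nonneg _)
      have hint : IntervalIntegrable (fun w => w / Real.sqrt (P - w ^ 2)) volume v A :=
        (intervalIntegrable_iff_integrableOn_Ioc_of_le hvA.le).2
          (intervalIntegral.integrableOn_deriv_of_nonneg hcont hder hnn)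
      rw [← ofReal_intervalIntegral hvA.le hint hnn,
        intervalIntegral.integral_eq_sub_of_hasDerivAt_of_le hvA.le hcont hder hint]
      simp [hA]
    · intro w hw
      have hAw : A ≤ w := by
        by_contra h
        exact hw.2 ⟨hw.1.1, not_le.1 h⟩
      exact key w (by nlinarith)

lemma chord_ratio_strictAnti {q z₁ z₂ : ℝ} (hq : 1 < q) (h0 : 0 < z₁) (h12 : z₁ < z₂)
    (h1 : z₂ < 1) : (1 - z₂) / (1 - z₂ ^ q) < (1 - z₁) / (1 - z₁ ^ q) := by
  have h := (strictConvexOn_rpow hq).secant_strict_mono (a := 1) (x := z₁) (y := z₂)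
    (by simp) (mem_Ici.2 h0.le) (mem_Ici.2 (h0.trans h12).le) (h12.trans h1).ne h1.ne h12
  have e1 : z₁ ^ q < 1 := Real.rpow_lt_one h0.le (h12.trans h1) (by linarith)
  have e2 : z₂ ^ q < 1 := Real.rpow_lt_one (h0.trans h12).le h1 (by linarith)
  simp only [Real.one_rpow] at h
  rw [← neg_div_neg_eq, ← neg_div_neg_eq (z₂ ^ q - 1), neg_sub, neg_sub, neg_sub, neg_sub,
    div_lt_div_iff₀ (by linarith) (by linarith)] at h
  rw [div_lt_div_iff₀ (by linarith) (by linarith)]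
  linarith

/-- The denominator of `angularRatio`. -/
noncomputable def angularDenom (m w θ : ℝ) : ℝ := w ^ 2 * Real.cos θ ^ 2 + m ^ 2 * Real.sin θ ^ 2

/-- The ratio `t ^ 2 / m ^ 2` as `t` runs from `m` to `w`, parametrised by `θ ∈ [0, π / 2]`. -/
noncomputable def angularRatio (m w θ : ℝ) : ℝ := w ^ 2 / angularDenom m w θ

/-- The function whose integral from `v` to `(1 / 4) ^ (1 / p)` is `g p v`. -/
noncomputable def angularIntegral (p m w : ℝ) : ℝ :=
  ∫ θ in (0 : ℝ)..π / 2,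
    2 * Real.sqrt ((1 - angularRatio m w θ) / (1 - angularRatio m w θ ^ (p / 2)))

/-- The substitution `y = r ^ p - 1 / 2` in terms of the angle `θ`. -/
noncomputable def angularCoord (p m w θ : ℝ) : ℝ :=
  1 / 2 * Real.sqrt (1 - angularRatio m w θ ^ (p / 2))

lemma angularDenom_eq (m w θ : ℝ) :
    angularDenom m w θ = w ^ 2 + (m ^ 2 - w ^ 2) * Real.sin θ ^ 2 := by
  rw [angularDenom, Real.cos_sq']
  ring

section

variable {p m w θ : ℝ}

lemma le_angularDenom (hw : 0 < w) (hwm : w < m) : w ^ 2 ≤ angularDenom m w θ := by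
  rw [angularDenom_eq]
  have : 0 ≤ m ^ 2 - w ^ 2 := by nlinarith
  have := mul_nonneg this (sq_nonneg (Real.sin θ))
  linarith

lemma angularDenom_pos (hw : 0 < w) (hwm : w < m) : 0 < angularDenom m w θ :=
  lt_of_lt_of_le (by positivity) (le_angularDenom hw hwm)

lemma angularRatio_pos (hw : 0 < w) (hwm : w < m) : 0 < angularRatio m w θ :=
  div_pos (by positivity) (angularDenom_pos hw hwm)

lemma angularRatio_le_one (hw : 0 < w) (hwm : w < m) : angularRatio m w θ ≤ 1 :=
  (div_le_one (angularDenom_pos hw hwm)).2 (le_angularDenom hw hwm)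

lemma angularRatio_strictAntiOn (hw : 0 < w) (hwm : w < m) :
    StrictAntiOn (angularRatio m w) (Icc 0 (π / 2)) := by
  intro a ha b hb hab
  refine div_lt_div_of_pos_left (by positivity) (angularDenom_pos hw hwm) ?_
  rw [angularDenom_eq, angularDenom_eq]
  have h0 : 0 ≤ Real.sin a :=
    Real.sin_nonneg_of_nonneg_of_le_pi ha.1 (by linarith [ha.2, Real.pi_pos])
  have h1 : Real.sin a < Real.sin b :=
    Real.sin_lt_sin_of_lt_of_le_pi_div_two (by linarith [ha.1, Real.pi_pos]) hb.2 hab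
  have h2 : 0 < m ^ 2 - w ^ 2 := by nlinarith
  have h3 := mul_lt_mul_of_pos_left (pow_lt_pow_left₀ h1 h0 two_ne_zero) h2
  linarith

lemma angularRatio_zero (hw : 0 < w) : angularRatio m w 0 = 1 := by
  simp [angularRatio, angularDenom, hw.ne']

lemma angularRatio_pi_div_two : angularRatio m w (π / 2) = w ^ 2 / m ^ 2 := by
  simp [angularRatio, angularDenom]

lemma angularRatio_lt_one (hw : 0 < w) (hwm : w < m) (hθ : θ ∈ Ioo 0 (π / 2)) :
    angularRatio m w θ < 1 := by
  have h := angularRatio_strictAntiOn hw hwm (left_mem_Icc.2 (by positivity))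
    (Ioo_subset_Icc_self hθ) hθ.1
  rwa [angularRatio_zero hw] at h

lemma angularRatio_lt_angularRatio {w₁ w₂ : ℝ} (hw : 0 < w₁) (h12 : w₁ < w₂) (hwm : w₂ < m)
    (hθ : θ ∈ Ioo 0 (π / 2)) : angularRatio m w₁ θ < angularRatio m w₂ θ := by
  rw [angularRatio, angularRatio, div_lt_div_iff₀ (angularDenom_pos hw (h12.trans hwm))
    (angularDenom_pos (hw.trans h12) hwm), angularDenom, angularDenom]
  have hs : 0 < Real.sin θ := Real.sin_pos_of_pos_of_lt_pi hθ.1 (by linarith [hθ.2, Real.pi_pos])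
  have h1 : w₁ ^ 2 < w₂ ^ 2 := pow_lt_pow_left₀ h12 hw.le two_ne_zero
  have h2 : 0 < m ^ 2 * Real.sin θ ^ 2 := by
    have : 0 < m := hw.trans (h12.trans hwm)
    positivity
  nlinarith [mul_lt_mul_of_pos_right h1 h2]

lemma continuous_angularRatio (hw : 0 < w) (hwm : w < m) : Continuous (angularRatio m w) := by
  refine continuous_const.div ?_ fun θ => (angularDenom_pos hw hwm).ne'
  unfold angularDenom
  fun_prop

lemma continuous_angularCoord (hp : 0 < p) (hw : 0 < w) (hwm : w < m) :
    Continuous (angularCoord p m w) :=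
  continuous_const.mul (continuous_const.sub
    ((continuous_angularRatio hw hwm).rpow_const fun _ => Or.inr (by positivity))).sqrt

lemma angularCoord_strictMonoOn (hp : 0 < p) (hw : 0 < w) (hwm : w < m) :
    StrictMonoOn (angularCoord p m w) (Icc 0 (π / 2)) := by
  intro a ha b hb hab
  have h1 := Real.rpow_lt_rpow (angularRatio_pos hw hwm).le
    (angularRatio_strictAntiOn hw hwm ha hb hab) (half_pos hp)
  have h2 := Real.rpow_le_one (angularRatio_pos hw hwm).le
    (angularRatio_le_one (θ := a) hw hwm) (half_pos hp).le
  have h3 := Real.sqrt_lt_sqrt (x := 1 - angularRatio m w a ^ (p / 2))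
    (y := 1 - angularRatio m w b ^ (p / 2)) (by linarith) (by linarith)
  simp only [angularCoord]
  linarith

lemma image_angularCoord (hp : 0 < p) (hw : 0 < w) (hwm : w < m) (hm : m ^ p = 1 / 4) :
    angularCoord p m w '' Ioo 0 (π / 2) = Ioo 0 (halfWidth p w) := by
  have h0 : angularCoord p m w 0 = 0 := by simp [angularCoord, angularRatio_zero hw]
  have h1 : angularCoord p m w (π / 2) = halfWidth p w := by
    have hm0 : 0 < m := hw.trans hwm
    have e : ∀ x : ℝ, 0 < x → (x ^ 2) ^ (p / 2) = x ^ p := fun x hx => by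
      rw [← Real.rpow_natCast_mul hx.le]
      congr 1
      push_cast
      ring
    rw [angularCoord, angularRatio_pi_div_two, Real.div_rpow (sq_nonneg _) (sq_nonneg _),
      e w hw, e m hm0, hm, halfWidth,
      show (1 : ℝ) / 4 - w ^ p = (1 / 2) ^ 2 * (1 - w ^ p / (1 / 4)) by ring,
      Real.sqrt_mul (by positivity), Real.sqrt_sq (by norm_num)]
  have hpi : (0 : ℝ) ≤ π / 2 := by positivity
  have hmono := angularCoord_strictMonoOn hp hw hwm
  apply Subset.antisymm
  · rintro _ ⟨θ, hθ, rfl⟩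
    rw [← h0, ← h1]
    exact ⟨hmono (left_mem_Icc.2 hpi) (Ioo_subset_Icc_self hθ) hθ.1,
      hmono (Ioo_subset_Icc_self hθ) (right_mem_Icc.2 hpi) hθ.2⟩
  · have := intermediate_value_Ioo hpi (continuous_angularCoord hp hw hwm).continuousOn
    rwa [h0, h1] at this

lemma hasDerivAt_angularCoord (hp : 0 < p) (hw : 0 < w) (hwm : w < m) (hθ : θ ∈ Ioo 0 (π / 2)) :
    HasDerivAt (angularCoord p m w)
      (p * angularRatio m w θ ^ (p / 2) * (m ^ 2 - w ^ 2) * Real.sin θ * Real.cos θ /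
        (4 * angularDenom m w θ * Real.sqrt (1 - angularRatio m w θ ^ (p / 2)))) θ := by
  have hD := angularDenom_pos (θ := θ) hw hwm
  have hZ := angularRatio_pos (θ := θ) hw hwm
  have hE : angularRatio m w θ ^ (p / 2) < 1 :=
    Real.rpow_lt_one hZ.le (angularRatio_lt_one hw hwm hθ) (half_pos hp)
  have hS : 0 < Real.sqrt (1 - angularRatio m w θ ^ (p / 2)) := Real.sqrt_pos.2 (by linarith)
  have d1 : HasDerivAt (angularDenom m w) (2 * (m ^ 2 - w ^ 2) * Real.sin θ * Real.cos θ) θ := by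
    refine ((((Real.hasDerivAt_cos θ).pow 2).const_mul (w ^ 2)).add
      (((Real.hasDerivAt_sin θ).pow 2).const_mul (m ^ 2))).congr_deriv ?_
    push_cast
    ring
  have d2 : HasDerivAt (angularRatio m w)
      (-(w ^ 2 * (2 * (m ^ 2 - w ^ 2) * Real.sin θ * Real.cos θ)) / angularDenom m w θ ^ 2) θ :=
    ((hasDerivAt_const θ (w ^ 2)).div d1 hD.ne').congr_deriv (by ring)
  refine (((d2.rpow_const (p := p / 2) (Or.inl hZ.ne')).const_sub 1).sqrt
    (by linarith)).const_mul (1 / 2) |>.congr_deriv ?_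
  rw [Real.rpow_sub hZ, Real.rpow_one]
  have hw2 : w ^ 2 = angularRatio m w θ * angularDenom m w θ := by
    rw [angularRatio, div_mul_cancel₀ _ hD.ne']
  generalize angularRatio m w θ ^ (p / 2) = E at *
  generalize angularRatio m w θ = Z at *
  generalize angularDenom m w θ = D at *
  generalize m ^ 2 - w ^ 2 = Δ
  rw [hw2]
  field_simp
  ring

lemma angularCoord_kernel_eq (hp : 0 < p) (hw : 0 < w) (hwm : w < m) (hm : m ^ p = 1 / 4)
    (hθ : θ ∈ Ioo 0 (π / 2)) :
    (p * angularRatio m w θ ^ (p / 2) * (m ^ 2 - w ^ 2) * Real.sin θ * Real.cos θ /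
        (4 * angularDenom m w θ * Real.sqrt (1 - angularRatio m w θ ^ (p / 2)))) *
      (2 / p * (w / Real.sqrt (profile p (angularCoord p m w θ) - w ^ 2) /
        (1 / 4 - angularCoord p m w θ ^ 2))) =
    2 * Real.sqrt ((1 - angularRatio m w θ) / (1 - angularRatio m w θ ^ (p / 2))) := by
  have hm0 : 0 < m := hw.trans hwm
  have hs : 0 < Real.sin θ := Real.sin_pos_of_pos_of_lt_pi hθ.1 (by linarith [hθ.2, Real.pi_pos])
  have hc : 0 < Real.cos θ := Real.cos_pos_of_mem_Ioo ⟨by linarith [hθ.1, Real.pi_pos], hθ.2⟩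
  have hD := angularDenom_pos (θ := θ) hw hwm
  have hZ := angularRatio_pos (θ := θ) hw hwm
  have hE0 : 0 < angularRatio m w θ ^ (p / 2) := Real.rpow_pos_of_pos hZ _
  have hE : angularRatio m w θ ^ (p / 2) < 1 :=
    Real.rpow_lt_one hZ.le (angularRatio_lt_one hw hwm hθ) (half_pos hp)
  have hS : 0 < Real.sqrt (1 - angularRatio m w θ ^ (p / 2)) := Real.sqrt_pos.2 (by linarith)
  have hΔ : 0 < m ^ 2 - w ^ 2 := by nlinarith
  have hT : 0 < Real.sqrt ((m ^ 2 - w ^ 2) / angularDenom m w θ) :=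
    Real.sqrt_pos.2 (div_pos hΔ hD)
  have hT2 : m ^ 2 - w ^ 2 =
      Real.sqrt ((m ^ 2 - w ^ 2) / angularDenom m w θ) ^ 2 * angularDenom m w θ := by
    rw [Real.sq_sqrt (div_pos hΔ hD).le, div_mul_cancel₀ _ hD.ne']
  have hy : 1 / 4 - angularCoord p m w θ ^ 2 = angularRatio m w θ ^ (p / 2) * m ^ p := by
    rw [angularCoord, mul_pow, Real.sq_sqrt (by linarith), hm]
    ring
  have hprof : profile p (angularCoord p m w θ) = angularRatio m w θ * m ^ 2 := by
    rw [profile, hy, Real.mul_rpow hE0.le (Real.rpow_pos_of_pos hm0 p).le,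
      ← Real.rpow_mul hZ.le, ← Real.rpow_mul hm0.le, div_mul_div_cancel₀ two_ne_zero,
      div_self hp.ne', Real.rpow_one, mul_div_cancel₀ _ hp.ne', Real.rpow_two]
  have hsq : profile p (angularCoord p m w θ) - w ^ 2 =
      (w * Real.cos θ) ^ 2 * ((m ^ 2 - w ^ 2) / angularDenom m w θ) := by
    rw [hprof, angularRatio]
    field_simp
    rw [angularDenom_eq, Real.cos_sq']
    ring
  have hone : 1 - angularRatio m w θ =
      Real.sin θ ^ 2 * ((m ^ 2 - w ^ 2) / angularDenom m w θ) := by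
    rw [angularRatio]
    field_simp
    rw [angularDenom_eq]
    ring
  rw [hsq, hy, hm, Real.sqrt_div' _ (by linarith), hone, Real.sqrt_mul (sq_nonneg _),
    Real.sqrt_mul (sq_nonneg _), Real.sqrt_sq hs.le, Real.sqrt_sq (by positivity)]
  generalize Real.sqrt ((m ^ 2 - w ^ 2) / angularDenom m w θ) = T at *
  rw [hT2]
  field_simp

lemma intervalIntegrable_angular (hp : 2 < p) (hw : 0 < w) (hwm : w < m) :
    IntervalIntegrable (fun θ =>
      2 * Real.sqrt ((1 - angularRatio m w θ) / (1 - angularRatio m w θ ^ (p / 2))))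
      volume 0 (π / 2) := by
  have hmeas := (continuous_angularRatio hw hwm).measurable
  refine (intervalIntegrable_const (c := (2 : ℝ))).mono_fun
    (Measurable.aestronglyMeasurable (by fun_prop)) ?_
  refine Filter.Eventually.of_forall fun θ => ?_
  have hZ := angularRatio_pos (θ := θ) hw hwm
  have hZ1 := angularRatio_le_one (θ := θ) hw hwm
  have hE : angularRatio m w θ ^ (p / 2) ≤ angularRatio m w θ := by
    simpa using Real.rpow_le_rpow_of_exponent_ge hZ hZ1 (show 1 ≤ p / 2 by linarith)
  have h1 : (1 - angularRatio m w θ) / (1 - angularRatio m w θ ^ (p / 2)) ≤ 1 :=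
    div_le_one_of_le₀ (by linarith) (by linarith)
  have h2 := Real.sqrt_le_one.2 h1
  beta_reduce
  rw [Real.norm_of_nonneg (by positivity), Real.norm_of_nonneg (by norm_num)]
  linarith

lemma angularIntegral_strictAntiOn (hp : 2 < p) :
    StrictAntiOn (angularIntegral p m) (Ioo 0 m) := by
  intro a ha b hb hab
  have ia := intervalIntegrable_angular hp ha.1 ha.2
  have ib := intervalIntegrable_angular hp hb.1 hb.2
  rw [← sub_pos, angularIntegral, angularIntegral, ← intervalIntegral.integral_sub ia ib]
  refine intervalIntegral.intervalIntegral_pos_of_pos_on (ia.sub ib) (fun θ hθ => ?_)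
    (by positivity)
  have hZ := angularRatio_pos (θ := θ) ha.1 ha.2
  have h1 := angularRatio_lt_one hb.1 hb.2 hθ
  have h := chord_ratio_strictAnti (show 1 < p / 2 by linarith) hZ
    (angularRatio_lt_angularRatio ha.1 hab hb.2 hθ) h1
  have hE : angularRatio m b θ ^ (p / 2) < 1 :=
    Real.rpow_lt_one (angularRatio_pos hb.1 hb.2).le h1 (by linarith)
  have := Real.sqrt_lt_sqrt (div_nonneg (by linarith) (by linarith)) h
  linarith

lemma angularIntegral_nonneg : 0 ≤ angularIntegral p m w :=
  intervalIntegral.integral_nonneg (by positivity) fun _ _ => by positivity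

lemma lintegral_kernel_eq (hp : 2 < p) (hw : 0 < w) (hwm : w < m) (hm : m ^ p = 1 / 4) :
    ∫⁻ y in Ioo (0 : ℝ) (1 / 2),
        ENNReal.ofReal (2 / p * (w / Real.sqrt (profile p y - w ^ 2) / (1 / 4 - y ^ 2))) =
      ENNReal.ofReal (angularIntegral p m w) := by
  have hp0 : 0 < p := by linarith
  rw [← setLIntegral_eq_of_eq_zero_on_diff (s := Ioo 0 (halfWidth p w)) measurableSet_Ioo
    measurableSet_Ioo (Ioo_subset_Ioo_right (halfWidth_lt hw).le), ← image_angularCoord hp0 hw hwm hm,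
    lintegral_image_eq_lintegral_abs_deriv_mul measurableSet_Ioo
      (fun θ hθ => (hasDerivAt_angularCoord hp0 hw hwm hθ).hasDerivWithinAt)
      ((angularCoord_strictMonoOn hp0 hw hwm).injOn.mono Ioo_subset_Icc_self),
    angularIntegral, ofReal_intervalIntegral (by positivity) (intervalIntegrable_angular hp hw hwm)
      (fun _ _ => by positivity)]
  · refine setLIntegral_congr_fun measurableSet_Ioo fun θ hθ => ?_
    have hs : 0 < Real.sin θ :=
      Real.sin_pos_of_pos_of_lt_pi hθ.1 (by linarith [hθ.2, Real.pi_pos])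
    have hc : 0 < Real.cos θ := Real.cos_pos_of_mem_Ioo ⟨by linarith [hθ.1, Real.pi_pos], hθ.2⟩
    have hD := angularDenom_pos (θ := θ) hw hwm
    have hE0 : 0 < angularRatio m w θ ^ (p / 2) :=
      Real.rpow_pos_of_pos (angularRatio_pos hw hwm) _
    have hΔ : 0 < m ^ 2 - w ^ 2 := by nlinarith
    rw [← ENNReal.ofReal_mul (abs_nonneg _), abs_of_nonneg (by positivity),
      angularCoord_kernel_eq hp0 hw hwm hm hθ]
  · intro y hy
    have h : halfWidth p w ≤ y := by
      by_contra h
      exact hy.2 ⟨hy.1.1, not_le.1 h⟩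
    have h' := (profile_le_sq_iff hp0 hw hy.1.1.le hy.1.2).2 h
    rw [Real.sqrt_eq_zero'.2 (by linarith)]
    simp

end

lemma ofReal_g {p m v : ℝ} (hp : 2 < p) (hv : 0 < v) (hvm : v < m) (hm : m ^ p = 1 / 4) :
    ENNReal.ofReal (g p v) = ∫⁻ w in Ioo v m, ENNReal.ofReal (angularIntegral p m w) := by
  have hp0 : 0 < p := by linarith
  have hm0 : 0 < m := hv.trans hvm
  have hS := halfWidth_lt (p := p) hv
  have hprof := continuous_profile hp0
  have hden : ∀ y ∈ Ioo (0 : ℝ) (1 / 2), 0 < 1 / 4 - y ^ 2 := fun y hy => by nlinarith [hy.1, hy.2]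
  rw [g_eq_integral_profile hp0 hv, ofReal_intervalIntegral (halfWidth_nonneg p v),
    setLIntegral_eq_of_eq_zero_on_diff (t := Ioo 0 (1 / 2)) measurableSet_Ioo measurableSet_Ioo
      (Ioo_subset_Ioo_right hS.le)]
  · have hswap : ∀ y ∈ Ioo (0 : ℝ) (1 / 2),
        ENNReal.ofReal (2 / p * (Real.sqrt (profile p y - v ^ 2) / (1 / 4 - y ^ 2))) =
          ∫⁻ w in Ioo v m, ENNReal.ofReal
            (2 / p * (w / Real.sqrt (profile p y - w ^ 2) / (1 / 4 - y ^ 2))) := by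
      intro y hy
      have hd := hden y hy
      have hP : profile p y ≤ m ^ 2 := by
        rw [profile_le_sq_iff hp0 hm0 hy.1.le hy.2, halfWidth, hm]
        simpa using hy.1.le
      have e : ∀ x : ℝ, 2 / p * (x / (1 / 4 - y ^ 2)) = 2 / p / (1 / 4 - y ^ 2) * x := fun x => by
        ring
      simp only [e]
      have hk : 0 ≤ 2 / p / (1 / 4 - y ^ 2) := by positivity
      simp only [ENNReal.ofReal_mul hk]
      rw [lintegral_const_mul _ (by fun_prop), ofReal_sqrt_sub_sq hv hm0 hP]
    rw [setLIntegral_congr_fun measurableSet_Ioo hswap, lintegral_lintegral_swap]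
    · exact setLIntegral_congr_fun measurableSet_Ioo fun w hw =>
        lintegral_kernel_eq hp (hv.trans hw.1) hw.2 hm
    · refine Measurable.aemeasurable ?_
      have := hprof.measurable
      unfold Function.uncurry
      fun_prop
  · intro y hy
    have h : halfWidth p v ≤ y := by
      by_contra h
      exact hy.2 ⟨hy.1.1, not_le.1 h⟩
    have h' := (profile_le_sq_iff hp0 hv hy.1.1.le hy.1.2).2 h
    rw [Real.sqrt_eq_zero'.2 (by linarith)]
    simp
  · refine ContinuousOn.intervalIntegrable_of_Icc (halfWidth_nonneg p v) ?_
    refine continuousOn_const.mul (ContinuousOn.div ?_ (by fun_prop) fun y hy => ?_)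
    · exact ((hprof.sub continuous_const).sqrt).continuousOn
    · nlinarith [hy.1, hy.2]
  · intro y hy
    have := hden y ⟨hy.1, hy.2.trans hS⟩
    positivity

lemma g_nonneg {p v : ℝ} (hp : 0 < p) (hv : 0 < v) : 0 ≤ g p v := by
  rw [g_eq_integral_profile hp hv]
  refine intervalIntegral.integral_nonneg (halfWidth_nonneg p v) fun y hy => ?_
  have : 0 < 1 / 4 - y ^ 2 := by nlinarith [hy.1, hy.2, halfWidth_lt (p := p) hv]
  positivity

lemma intervalIntegrable_angularIntegral {p m x y : ℝ} (hp : 2 < p) (hx : 0 < x) (hxy : x ≤ y)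
    (hy : y < m) : IntervalIntegrable (angularIntegral p m) volume x y := by
  refine AntitoneOn.intervalIntegrable ((angularIntegral_strictAntiOn hp).antitoneOn.mono ?_)
  rw [uIcc_of_le hxy]
  exact fun z hz => ⟨hx.trans_le hz.1, hz.2.trans_lt hy⟩

lemma g_sub_g_s5 {p m x y : ℝ} (hp : 2 < p) (hx : 0 < x) (hxy : x ≤ y) (hy : y < m)
    (hm : m ^ p = 1 / 4) : g p x - g p y = ∫ w in x..y, angularIntegral p m w := by
  have hp0 : 0 < p := by linarith
  have h : ENNReal.ofReal (g p x) =
      ENNReal.ofReal ((∫ w in x..y, angularIntegral p m w) + g p y) := by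
    rw [ENNReal.ofReal_add (intervalIntegral.integral_nonneg hxy fun _ _ => angularIntegral_nonneg)
      (g_nonneg hp0 (hx.trans_le hxy)), ofReal_g hp hx (hxy.trans_lt hy) hm,
      ofReal_g hp (hx.trans_le hxy) hy hm,
      ofReal_intervalIntegral hxy (intervalIntegrable_angularIntegral hp hx hxy hy)
        (fun _ _ => angularIntegral_nonneg),
      setLIntegral_congr (Ioo_ae_eq_Ioc (a := x) (b := y)),
      ← lintegral_union measurableSet_Ioo (by
        rw [Set.disjoint_left]
        exact fun z h1 h2 => absurd h1.2 (not_le.2 h2.1)),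
      Ioc_union_Ioo_eq_Ioo hxy hy]
  have h0 : 0 ≤ ∫ w in x..y, angularIntegral p m w :=
    intervalIntegral.integral_nonneg hxy fun _ _ => angularIntegral_nonneg
  rw [ENNReal.ofReal_eq_ofReal_iff (g_nonneg hp0 hx)
    (add_nonneg h0 (g_nonneg hp0 (hx.trans_le hxy)))] at h
  linarith

/-- for `p > 2`, `g_p` is strictly convex on `(0, (1/4)^(1/p))`. -/
theorem g_strictConvexOn (p : ℝ) (hp : 2 < p) :
    StrictConvexOn ℝ (Set.Ioo (0 : ℝ) ((1 / 4 : ℝ) ^ (1 / p))) (g p) := by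
  have hm : ((1 / 4 : ℝ) ^ (1 / p)) ^ p = 1 / 4 := by
    rw [← Real.rpow_mul (by norm_num), one_div_mul_cancel (by linarith), Real.rpow_one]
  set m := (1 / 4 : ℝ) ^ (1 / p)
  refine strictConvexOn_of_slope_strict_mono_adjacent (convex_Ioo 0 m) ?_
  intro x y z hx hz hxy hyz
  have hy : y ∈ Ioo 0 m := ⟨hx.1.trans hxy, hyz.trans hz.2⟩
  have hanti := angularIntegral_strictAntiOn (m := m) hp
  have i1 := intervalIntegrable_angularIntegral hp hx.1 hxy.le hy.2
  have i2 := intervalIntegrable_angularIntegral hp hy.1 hyz.le hz.2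
  have h1 : 0 < ∫ w in x..y, (angularIntegral p m w - angularIntegral p m y) :=
    intervalIntegral.intervalIntegral_pos_of_pos_on (i1.sub intervalIntegrable_const)
      (fun w hw => sub_pos.2 (hanti ⟨hx.1.trans hw.1, hw.2.trans hy.2⟩ hy hw.2)) hxy
  have h2 : 0 < ∫ w in y..z, (angularIntegral p m y - angularIntegral p m w) :=
    intervalIntegral.intervalIntegral_pos_of_pos_on (intervalIntegrable_const.sub i2)
      (fun w hw => sub_pos.2 (hanti hy ⟨hy.1.trans hw.1, hw.2.trans hz.2⟩ hw.1)) hyz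
  rw [intervalIntegral.integral_sub i1 intervalIntegrable_const,
    intervalIntegral.integral_const, smul_eq_mul, ← g_sub_g_s5 hp hx.1 hxy.le hy.2 hm] at h1
  rw [intervalIntegral.integral_sub intervalIntegrable_const i2,
    intervalIntegral.integral_const, smul_eq_mul, ← g_sub_g_s5 hp hy.1 hyz.le hz.2 hm] at h2
  calc (g p y - g p x) / (y - x) < -angularIntegral p m y := by
        rw [div_lt_iff₀ (sub_pos.2 hxy)]
        linarith
    _ < (g p z - g p y) / (z - y) := by
        rw [lt_div_iff₀ (sub_pos.2 hyz)]
        linarith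
end

section
/- For p = 2, one has g_2(v) = π/2 − π·v for every v ∈ [0, 1/2]; that is, for every v ∈ [0, 1/2], 2∫_{r₋(v)}^{r₊(v)} √((1 − r²) − v²/r²) dr = π/2 − π·v, where r₋(v) = √(1/2 − √(1/4 − v²)) and r₊(v) = √(1/2 + √(1/4 − v²)). -/
open Real

/-- An antiderivative of `r ↦ √((1 - r²) - v²/r²)`, where `q = √(1/4 - v²)`. -/
noncomputable def sqrtPrimitive (v q r : ℝ) : ℝ :=
  1 / 2 * (√(r ^ 2 - (r ^ 2) ^ 2 - v ^ 2) + 1 / 2 * arcsin ((r ^ 2 - 1 / 2) / q)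
    - v * arcsin ((r ^ 2 - 2 * v ^ 2) / (2 * r ^ 2 * q)))

lemma hasDerivAt_arcsin_comp {f : ℝ → ℝ} {f' x w : ℝ} (hf : HasDerivAt f f' x) (hw : 0 < w)
    (h : 1 - f x ^ 2 = w ^ 2) : HasDerivAt (fun r => arcsin (f r)) (f' / w) x := by
  have hpos : 0 < w ^ 2 := by positivity
  have h₁ : f x ≠ -1 := by
    intro e
    rw [e] at h
    linarith
  have h₂ : f x ≠ 1 := by
    intro e
    rw [e] at h
    linarith
  have := (hasDerivAt_arcsin h₁ h₂).comp x hf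
  rw [h, sqrt_sq hw.le] at this
  exact this.congr_deriv (by ring)

lemma hasDerivAt_sqrtPrimitive {v q r : ℝ} (hv : 0 ≤ v) (hq : 0 < q) (hqv : q ^ 2 = 1 / 4 - v ^ 2)
    (hr : 0 < r) (hD : 0 < r ^ 2 - (r ^ 2) ^ 2 - v ^ 2) :
    HasDerivAt (sqrtPrimitive v q) (√((1 - r ^ 2) - v ^ 2 / r ^ 2)) r := by
  obtain ⟨d, hd⟩ : ∃ d, d = √(r ^ 2 - (r ^ 2) ^ 2 - v ^ 2) := ⟨_, rfl⟩
  have hd0 : 0 < d := hd ▸ sqrt_pos.2 hD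
  have hdsq : d ^ 2 = r ^ 2 - (r ^ 2) ^ 2 - v ^ 2 := by rw [hd, sq_sqrt hD.le]
  have hs : HasDerivAt (fun x : ℝ => x ^ 2) (2 * r) r := by simpa using hasDerivAt_pow 2 r
  have hroot : HasDerivAt (fun x : ℝ => √(x ^ 2 - (x ^ 2) ^ 2 - v ^ 2))
      ((2 * r - 2 * r ^ 2 * (2 * r)) / (2 * d)) r := by
    have := ((hs.sub (hs.pow 2)).sub_const (v ^ 2)).sqrt hD.ne'
    refine this.congr_deriv ?_
    simp [hd]
  have harc : HasDerivAt (fun x : ℝ => arcsin ((x ^ 2 - 1 / 2) / q)) (2 * r / q / (d / q)) r := by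
    refine hasDerivAt_arcsin_comp ((hs.sub_const _).div_const q) (by positivity) ?_
    field_simp
    rw [hdsq, hqv]
    ring
  have hmul : HasDerivAt (fun x : ℝ => v * arcsin ((x ^ 2 - 2 * v ^ 2) / (2 * x ^ 2 * q)))
      (2 * v ^ 2 / (r * d)) r := by
    rcases hv.eq_or_lt with rfl | hv
    · simpa using hasDerivAt_const r (0 : ℝ)
    have hquot := (hs.sub_const (2 * v ^ 2)).div ((hs.const_mul 2).mul_const q)
      (by positivity : 2 * r ^ 2 * q ≠ 0)
    have := (hasDerivAt_arcsin_comp hquot (w := v * d / (r ^ 2 * q)) (by positivity) (by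
      simp only [Pi.div_apply]
      field_simp
      rw [hdsq, hqv]
      ring)).const_mul v
    refine this.congr_deriv ?_
    field_simp
    ring
  refine (((hroot.add (harc.const_mul (1 / 2))).sub hmul).const_mul (1 / 2)).congr_deriv ?_
  have hval : (1 - r ^ 2) - v ^ 2 / r ^ 2 = (d / r) ^ 2 := by
    rw [div_pow, hdsq]
    field_simp
  rw [hval, sqrt_sq (by positivity)]
  field_simp
  rw [hdsq]
  ring

lemma continuousOn_sqrtPrimitive {v q a b : ℝ} (hq : 0 < q) (ha : v ≠ 0 → 0 < a) :
    ContinuousOn (sqrtPrimitive v q) (Set.Icc a b) := by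
  have hmul : ContinuousOn (fun x : ℝ => v * arcsin ((x ^ 2 - 2 * v ^ 2) / (2 * x ^ 2 * q)))
      (Set.Icc a b) := by
    by_cases hv : v = 0
    · simpa [hv] using continuousOn_const
    refine continuousOn_const.mul (continuous_arcsin.comp_continuousOn ?_)
    refine ContinuousOn.div (by fun_prop) (by fun_prop) fun x hx => ?_
    have : 0 < x := (ha hv).trans_le hx.1
    positivity
  have harc : Continuous fun x : ℝ => arcsin ((x ^ 2 - 1 / 2) / q) :=
    continuous_arcsin.comp (by fun_prop)
  have hroot : Continuous fun x : ℝ => √(x ^ 2 - (x ^ 2) ^ 2 - v ^ 2) := by fun_prop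
  exact continuousOn_const.mul
    ((hroot.continuousOn.add (continuousOn_const.mul harc.continuousOn)).sub hmul)

lemma sqrtPrimitive_of_sq_eq_add {v q r : ℝ} (hq : 0 < q) (hqv : q ^ 2 = 1 / 4 - v ^ 2)
    (hr : r ^ 2 = 1 / 2 + q) : sqrtPrimitive v q r = π / 8 - π * v / 4 := by
  have h₁ : r ^ 2 - (r ^ 2) ^ 2 - v ^ 2 = 0 := by
    rw [hr]
    linarith
  have h₂ : (r ^ 2 - 1 / 2) / q = 1 := by
    rw [hr]
    field_simp
    ring
  have h₃ : (r ^ 2 - 2 * v ^ 2) / (2 * r ^ 2 * q) = 1 := by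
    rw [hr, div_eq_one_iff_eq (by positivity)]
    linarith
  rw [sqrtPrimitive, h₁, h₂, h₃, sqrt_zero, arcsin_one]
  ring

lemma sqrtPrimitive_of_sq_eq_sub {v q r : ℝ} (hq : 0 < q) (hqv : q ^ 2 = 1 / 4 - v ^ 2)
    (hr : r ^ 2 = 1 / 2 - q) : sqrtPrimitive v q r = -(π / 8 - π * v / 4) := by
  have h₁ : r ^ 2 - (r ^ 2) ^ 2 - v ^ 2 = 0 := by
    rw [hr]
    linarith
  have h₂ : (r ^ 2 - 1 / 2) / q = -1 := by
    rw [hr]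
    field_simp
    ring
  have h₃ : v * arcsin ((r ^ 2 - 2 * v ^ 2) / (2 * r ^ 2 * q)) = v * -(π / 2) := by
    by_cases hv : v = 0
    · simp [hv]
    have hne : r ^ 2 ≠ 0 := by
      intro h
      rw [h] at h₁
      exact hv (by simpa using h₁)
    have : (r ^ 2 - 2 * v ^ 2) / (2 * r ^ 2 * q) = -1 := by
      rw [div_eq_iff (by positivity), hr]
      linarith
    rw [this, arcsin_neg_one]
  rw [sqrtPrimitive, h₁, h₂, h₃, sqrt_zero, arcsin_neg_one]
  ring

/-- for every `v ∈ [0, 1/2]`,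
`2∫_{√(1/2−√(1/4−v²))}^{√(1/2+√(1/4−v²))} √((1 − r²) − v²/r²) dr = π/2 − π·v`,
i.e. `g_2(v) = π/2 − πv`. -/
theorem g_two_eq (v : ℝ) (hv : v ∈ Set.Icc (0 : ℝ) (1 / 2)) :
    2 * ∫ r in Real.sqrt (1 / 2 - Real.sqrt (1 / 4 - v ^ 2))..
        Real.sqrt (1 / 2 + Real.sqrt (1 / 4 - v ^ 2)),
        Real.sqrt ((1 - r ^ 2) - v ^ 2 / r ^ 2) = π / 2 - π * v := by
  obtain ⟨hv0, hv1⟩ := hv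
  have hnn : 0 ≤ 1 / 4 - v ^ 2 := by nlinarith
  obtain ⟨q, hq⟩ : ∃ q, q = √(1 / 4 - v ^ 2) := ⟨_, rfl⟩
  have hqv : q ^ 2 = 1 / 4 - v ^ 2 := by rw [hq, sq_sqrt hnn]
  have hq0 : 0 ≤ q := hq ▸ sqrt_nonneg _
  rw [← hq]
  rcases hq0.eq_or_lt with rfl | hq0
  · have : v = 1 / 2 := by nlinarith
    rw [sub_zero, add_zero, intervalIntegral.integral_same, this]
    ring
  have hq1 : q ≤ 1 / 2 := by nlinarith
  have ha : √(1 / 2 - q) ^ 2 = 1 / 2 - q := sq_sqrt (by linarith)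
  have hb : √(1 / 2 + q) ^ 2 = 1 / 2 + q := sq_sqrt (by linarith)
  have hab : √(1 / 2 - q) ≤ √(1 / 2 + q) := sqrt_le_sqrt (by linarith)
  have hcont : ContinuousOn (sqrtPrimitive v q) (Set.Icc √(1 / 2 - q) √(1 / 2 + q)) := by
    refine continuousOn_sqrtPrimitive hq0 fun hv => sqrt_pos.2 ?_
    have : 0 < v ^ 2 := by positivity
    nlinarith
  have hderiv : ∀ r ∈ Set.Ioo √(1 / 2 - q) √(1 / 2 + q),
      HasDerivAt (sqrtPrimitive v q) (√((1 - r ^ 2) - v ^ 2 / r ^ 2)) r := by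
    rintro r ⟨hr₁, hr₂⟩
    have hr : 0 < r := (sqrt_nonneg _).trans_lt hr₁
    have h₁ : 1 / 2 - q < r ^ 2 := (sqrt_lt' hr).1 hr₁
    have h₂ : r ^ 2 < 1 / 2 + q := (lt_sqrt hr.le).1 hr₂
    exact hasDerivAt_sqrtPrimitive hv0 hq0 hqv hr (by nlinarith)
  have hint := intervalIntegral.intervalIntegrable_deriv_of_nonneg
    (by rwa [Set.uIcc_of_le hab]) (by rwa [min_eq_left hab, max_eq_right hab])
    (fun r _ => sqrt_nonneg ((1 - r ^ 2) - v ^ 2 / r ^ 2))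
  rw [intervalIntegral.integral_eq_sub_of_hasDerivAt_of_le hab hcont hderiv hint,
    sqrtPrimitive_of_sq_eq_add hq0 hqv hb, sqrtPrimitive_of_sq_eq_sub hq0 hqv ha]
  ring
end

section
/- For every real p ≥ 1, the derivative of g_p satisfies lim_{v→0⁺} g_p'(v) = −π and lim_{v→((1/4)^(1/p))⁻} g_p'(v) = −√(2/p)·π. -/
open Real

section

open MeasureTheory Set Filter Topology

lemma rpow_lt_quarter_s7 {p v : ℝ} (hp : 0 < p) (hv : 0 < v) (hvW : v < (1 / 4 : ℝ) ^ (1 / p)) :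
    v ^ p < 1 / 4 := by
  have h := Real.rpow_lt_rpow hv.le hvW hp
  rwa [← Real.rpow_mul (by norm_num), one_div_mul_cancel hp.ne', Real.rpow_one] at h

lemma rpow_rpow_two_div {p v : ℝ} (hp : 0 < p) (hv : 0 ≤ v) : (v ^ p) ^ (2 / p) = v ^ 2 := by
  rw [← Real.rpow_mul hv, mul_div_cancel₀ _ hp.ne', ← Real.rpow_natCast]
  norm_num

/-- The substitution `s = r ^ p` in the integral defining `g`. -/
lemma g_eq_integral_rpow {p v : ℝ} (hp : 0 < p) (hv : 0 < v) :
    g p v = 2 / p * ∫ s in (1 / 2 - √(1 / 4 - v ^ p))..(1 / 2 + √(1 / 4 - v ^ p)),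
      √((s * (1 - s)) ^ (2 / p) - v ^ 2) / s := by
  have ha : 0 < v ^ p := Real.rpow_pos_of_pos hv p
  set d := √(1 / 4 - v ^ p) with hd
  have hd0 : 0 ≤ d := Real.sqrt_nonneg _
  have hd1 : d < 1 / 2 := by
    rw [hd, Real.sqrt_lt' (by norm_num)]; linarith
  have huIcc : uIcc (1 / 2 - d) (1 / 2 + d) = Icc (1 / 2 - d) (1 / 2 + d) :=
    uIcc_of_le (by linarith)
  have key := intervalIntegral.integral_comp_mul_deriv'' (a := 1 / 2 - d) (b := 1 / 2 + d)
    (f := fun s => s ^ (1 / p)) (f' := fun s => 1 / p * s ^ (1 / p - 1))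
    (g := fun r => √((1 - r ^ p) ^ (2 / p) - v ^ 2 / r ^ 2)) ?_ ?_ ?_ ?_
  · unfold g rMinus rPlus
    rw [← hd, ← key, ← intervalIntegral.integral_const_mul, ← intervalIntegral.integral_const_mul]
    refine intervalIntegral.integral_congr fun s hs => ?_
    rw [huIcc] at hs
    have hs0 : 0 < s := by linarith [hs.1]
    have hs1 : 0 < 1 - s := by linarith [hs.2]
    have hr0 : 0 < s ^ (1 / p) := Real.rpow_pos_of_pos hs0 _
    have e1 : (s ^ (1 / p)) ^ p = s := by
      rw [← Real.rpow_mul hs0.le, one_div_mul_cancel hp.ne', Real.rpow_one]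
    have e2 : s ^ (2 / p) = (s ^ (1 / p)) ^ 2 := by
      rw [← Real.rpow_natCast, ← Real.rpow_mul hs0.le]; congr 1; push_cast; ring
    have e3 : (s * (1 - s)) ^ (2 / p) - v ^ 2
        = (s ^ (1 / p)) ^ 2 * ((1 - s) ^ (2 / p) - v ^ 2 / (s ^ (1 / p)) ^ 2) := by
      rw [Real.mul_rpow hs0.le hs1.le, e2]; field_simp
    simp only [Function.comp]
    rw [e3, e1, Real.sqrt_mul (by positivity), Real.sqrt_sq hr0.le, Real.rpow_sub_one hs0.ne']
    ring
  · exact (Real.continuous_rpow_const (by positivity)).continuousOn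
  · intro s hs
    have hs0 : s ≠ 0 := by
      rw [min_eq_left (by linarith)] at hs
      have := hs.1
      intro h; linarith
    exact (Real.hasDerivAt_rpow_const (Or.inl hs0)).hasDerivWithinAt
  · rw [huIcc]
    refine ContinuousOn.mul continuousOn_const (ContinuousOn.rpow_const continuousOn_id ?_)
    intro s hs
    left
    have := hs.1
    intro h; linarith
  · rw [huIcc]
    rintro r ⟨s, hs, rfl⟩
    have hs0 : 0 < s := by linarith [hs.1]
    have hr0 : (s ^ (1 / p)) ^ 2 ≠ 0 := (pow_pos (Real.rpow_pos_of_pos hs0 _) 2).ne'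
    refine ContinuousAt.continuousWithinAt ?_
    refine ContinuousAt.sqrt (ContinuousAt.sub ?_ ?_)
    · refine ContinuousAt.rpow_const ?_ (Or.inr (by positivity))
      exact continuousAt_const.sub (Real.continuous_rpow_const hp.le).continuousAt
    · exact continuousAt_const.div (by fun_prop) hr0

lemma rpow_sub_sq_nonpos {p v q : ℝ} (hp : 0 < p) (hv : 0 < v) (hq : 0 ≤ q) (h : q ≤ v ^ p) :
    q ^ (2 / p) - v ^ 2 ≤ 0 := by
  have := Real.rpow_le_rpow hq h (by positivity : 0 ≤ 2 / p)
  rw [rpow_rpow_two_div hp hv.le] at this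
  linarith

/-- Averaging over the reflection `s ↦ 1 - s`, and extending by zero. -/
lemma g_eq_setIntegral {p v : ℝ} (hp : 0 < p) (hv : 0 < v) (hv4 : v ^ p < 1 / 4) :
    g p v = 2 / p * ∫ s in Ioo (1 / 2 : ℝ) 1,
      √((s * (1 - s)) ^ (2 / p) - v ^ 2) / (s * (1 - s)) := by
  rw [g_eq_integral_rpow hp hv]
  have ha : 0 < v ^ p := Real.rpow_pos_of_pos hv p
  set d := √(1 / 4 - v ^ p) with hd
  have hd0 : 0 ≤ d := Real.sqrt_nonneg _
  have hd1 : d < 1 / 2 := by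
    rw [hd, Real.sqrt_lt' (by norm_num)]; linarith
  have hd2 : d ^ 2 = 1 / 4 - v ^ p := Real.sq_sqrt (by linarith)
  have hcont : ∀ a b : ℝ, 0 < a → a ≤ b → IntervalIntegrable
      (fun s => √((s * (1 - s)) ^ (2 / p) - v ^ 2) / s) volume a b := by
    intro a b ha hab
    refine ContinuousOn.intervalIntegrable ?_
    rw [uIcc_of_le hab]
    intro s hs
    have : s ≠ 0 := by have := hs.1; intro h; linarith
    refine ContinuousAt.continuousWithinAt (ContinuousAt.div ?_ continuousAt_id this)
    refine ContinuousAt.sqrt (ContinuousAt.sub ?_ continuousAt_const)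
    exact ContinuousAt.rpow_const (by fun_prop) (Or.inr (by positivity))
  have hcont' : IntervalIntegrable
      (fun s => √((s * (1 - s)) ^ (2 / p) - v ^ 2) / (1 - s)) volume (1 / 2) (1 / 2 + d) := by
    refine ContinuousOn.intervalIntegrable ?_
    rw [uIcc_of_le (by linarith)]
    intro s hs
    have : 1 - s ≠ 0 := by have := hs.2; intro h; linarith
    refine ContinuousAt.continuousWithinAt (ContinuousAt.div ?_ (by fun_prop) this)
    refine ContinuousAt.sqrt (ContinuousAt.sub ?_ continuousAt_const)
    exact ContinuousAt.rpow_const (by fun_prop) (Or.inr (by positivity))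
  have hrefl := intervalIntegral.integral_comp_sub_left (a := 1 / 2) (b := 1 / 2 + d)
    (fun s => √((s * (1 - s)) ^ (2 / p) - v ^ 2) / s) 1
  rw [show (1 : ℝ) - (1 / 2 + d) = 1 / 2 - d by ring, show (1 : ℝ) - 1 / 2 = 1 / 2 by norm_num]
    at hrefl
  rw [← intervalIntegral.integral_add_adjacent_intervals
    (hcont (1 / 2 - d) (1 / 2) (by linarith) (by linarith))
    (hcont (1 / 2) (1 / 2 + d) (by norm_num) (by linarith)), ← hrefl]
  have hsimp : (fun x : ℝ => √(((1 - x) * (1 - (1 - x))) ^ (2 / p) - v ^ 2) / (1 - x))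
      = fun s => √((s * (1 - s)) ^ (2 / p) - v ^ 2) / (1 - s) := by
    funext s
    rw [show (1 - s) * (1 - (1 - s)) = s * (1 - s) by ring]
  rw [hsimp, ← intervalIntegral.integral_add hcont' (hcont _ _ (by norm_num) (by linarith)),
    intervalIntegral.integral_of_le (by linarith), integral_Ioc_eq_integral_Ioo]
  congr 1
  rw [setIntegral_eq_of_subset_of_forall_sdiff_eq_zero (s := Ioo (1 / 2 : ℝ) (1 / 2 + d))
    (t := Ioo (1 / 2 : ℝ) 1) measurableSet_Ioo (Ioo_subset_Ioo_right (by linarith))]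
  · refine setIntegral_congr_fun measurableSet_Ioo fun s hs => ?_
    have h1 : s ≠ 0 := by have := hs.1; intro h; linarith
    have h2 : 1 - s ≠ 0 := by have := hs.2; intro h; linarith
    field_simp
    ring
  · rintro s ⟨hs, hs'⟩
    have hs2 : 1 / 2 + d ≤ s := by
      by_contra h
      exact hs' ⟨hs.1, not_le.mp h⟩
    rw [Real.sqrt_eq_zero_of_nonpos, zero_div]
    refine rpow_sub_sq_nonpos hp hv (by nlinarith [hs.1, hs.2]) ?_
    nlinarith

/-- `∫ u in v..W, u / √(c² - u²) = √(c² - v²)`; the integrand vanishes for `u > c`. -/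
lemma integral_div_sqrt_sq_sub {c v W : ℝ} (hc : 0 ≤ c) (hcW : c ≤ W) (hv : 0 < v) (hvW : v ≤ W) :
    IntervalIntegrable (fun u => u / √(c ^ 2 - u ^ 2)) volume v W ∧
    ∫ u in v..W, u / √(c ^ 2 - u ^ 2) = √(c ^ 2 - v ^ 2) := by
  have hF : Continuous fun u : ℝ => -√(c ^ 2 - u ^ 2) := by fun_prop
  have hder : ∀ u, 0 < u → u ≠ c →
      HasDerivAt (fun u : ℝ => -√(c ^ 2 - u ^ 2)) (u / √(c ^ 2 - u ^ 2)) u := by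
    intro u hu huc
    have hne : c ^ 2 - u ^ 2 ≠ 0 := by
      intro h
      exact huc (((sq_eq_sq₀ hc hu.le).mp (by linarith)).symm)
    have h1 : HasDerivAt (fun u : ℝ => c ^ 2 - u ^ 2) (-(2 * u)) u := by
      simpa using ((hasDerivAt_pow 2 u).const_sub (c ^ 2))
    refine (h1.sqrt hne).fun_neg.congr_deriv ?_
    by_cases h0 : √(c ^ 2 - u ^ 2) = 0
    · simp [h0]
    · field_simp
  have hint : ∀ a b, 0 < a → a ≤ b → (b ≤ c ∨ c ≤ a) →
      IntervalIntegrable (fun u => u / √(c ^ 2 - u ^ 2)) volume a b := by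
    intro a b ha hab h
    rw [intervalIntegrable_iff_integrableOn_Ioc_of_le hab]
    refine intervalIntegral.integrableOn_deriv_of_nonneg hF.continuousOn
      (fun u hu => hder u (ha.trans hu.1) ?_) fun u hu => ?_
    · rintro rfl
      rcases h with h | h
      · exact absurd hu.2 (not_lt.mpr h)
      · exact absurd hu.1 (not_lt.mpr h)
    · have := ha.trans hu.1
      positivity
  have hI : IntervalIntegrable (fun u => u / √(c ^ 2 - u ^ 2)) volume v W := by
    rcases le_total c v with h | h
    · exact hint v W hv hvW (Or.inr h)
    · exact (hint v c hv h (Or.inl le_rfl)).trans (hint c W (hv.trans_le h) hcW (Or.inr le_rfl))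
  refine ⟨hI, ?_⟩
  rw [integral_eq_of_hasDerivAt_off_countable_of_le _ _ hvW (countable_singleton c)
    hF.continuousOn (fun u hu => hder u (hv.trans hu.1.1) hu.2) hI,
    Real.sqrt_eq_zero_of_nonpos (x := c ^ 2 - W ^ 2) (by nlinarith)]
  ring

/-- The negative of the derivative of `g p`. -/
noncomputable def negDerivG (p u : ℝ) : ℝ :=
  2 / p * ∫ s in Ioo (1 / 2 : ℝ) 1,
    u / √((s * (1 - s)) ^ (2 / p) - u ^ 2) / (s * (1 - s))

lemma g_eq_integral_negDerivG {p v : ℝ} (hp : 0 < p) (hv : 0 < v)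
    (hvW : v < (1 / 4 : ℝ) ^ (1 / p)) :
    IntervalIntegrable (negDerivG p) volume v ((1 / 4 : ℝ) ^ (1 / p)) ∧
    g p v = ∫ u in v..(1 / 4 : ℝ) ^ (1 / p), negDerivG p u := by
  have hv4 := rpow_lt_quarter_s7 hp hv hvW
  have ha : 0 < v ^ p := Real.rpow_pos_of_pos hv p
  set W := (1 / 4 : ℝ) ^ (1 / p) with hW
  set F : ℝ → ℝ → ℝ := fun s u => u / √((s * (1 - s)) ^ (2 / p) - u ^ 2) / (s * (1 - s)) with hF
  have inner : ∀ s ∈ Ioo (1 / 2 : ℝ) 1, Integrable (F s) (volume.restrict (Ioc v W)) ∧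
      ∫ u in Ioc v W, F s u = √((s * (1 - s)) ^ (2 / p) - v ^ 2) / (s * (1 - s)) := by
    intro s hs
    have hq : 0 < s * (1 - s) := mul_pos (by linarith [hs.1]) (by linarith [hs.2])
    have hq4 : s * (1 - s) ≤ 1 / 4 := by nlinarith [sq_nonneg (s - 1 / 2)]
    have e : (s * (1 - s)) ^ (2 / p) = ((s * (1 - s)) ^ (1 / p)) ^ 2 := by
      rw [← Real.rpow_natCast, ← Real.rpow_mul hq.le]; congr 1; push_cast; ring
    have := integral_div_sqrt_sq_sub (c := (s * (1 - s)) ^ (1 / p)) (by positivity)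
      (Real.rpow_le_rpow hq.le hq4 (by positivity)) hv hvW.le
    rw [intervalIntegrable_iff_integrableOn_Ioc_of_le hvW.le,
      intervalIntegral.integral_of_le hvW.le, ← e] at this
    refine ⟨this.1.div_const _, ?_⟩
    rw [hF]
    simp only
    rw [integral_div, this.2]
  have hFnn : ∀ s ∈ Ioo (1 / 2 : ℝ) 1, ∀ u ∈ Ioc v W, 0 ≤ F s u := by
    intro s hs u hu
    have hq : 0 < s * (1 - s) := mul_pos (by linarith [hs.1]) (by linarith [hs.2])
    have := hv.trans hu.1
    simp only [hF]
    positivity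
  have hint : Integrable (Function.uncurry F)
      ((volume.restrict (Ioo (1 / 2 : ℝ) 1)).prod (volume.restrict (Ioc v W))) := by
    have hmeas : Measurable (Function.uncurry F) := by
      simp only [hF, Function.uncurry_def]
      fun_prop
    rw [integrable_prod_iff hmeas.aestronglyMeasurable]
    constructor
    · filter_upwards [ae_restrict_mem measurableSet_Ioo] with s hs
      exact (inner s hs).1
    · have hcongr : ∀ s ∈ Ioo (1 / 2 : ℝ) 1, ∫ u in Ioc v W, ‖Function.uncurry F (s, u)‖
          = √((s * (1 - s)) ^ (2 / p) - v ^ 2) / (s * (1 - s)) := by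
        intro s hs
        rw [← (inner s hs).2]
        refine setIntegral_congr_fun measurableSet_Ioc fun u hu => ?_
        exact Real.norm_of_nonneg (hFnn s hs u hu)
      change IntegrableOn _ _ _
      rw [integrableOn_congr_fun hcongr measurableSet_Ioo]
      refine Measure.integrableOn_of_bounded (M := 1 / v ^ p) (by simp) ?_ ?_
      · refine Measurable.aestronglyMeasurable ?_
        fun_prop
      · filter_upwards [ae_restrict_mem measurableSet_Ioo] with s hs
        have hq : 0 < s * (1 - s) := mul_pos (by linarith [hs.1]) (by linarith [hs.2])
        have hq4 : s * (1 - s) ≤ 1 / 4 := by nlinarith [sq_nonneg (s - 1 / 2)]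
        rw [Real.norm_of_nonneg (by positivity)]
        rcases le_total (s * (1 - s)) (v ^ p) with h | h
        · rw [Real.sqrt_eq_zero_of_nonpos (rpow_sub_sq_nonpos hp hv hq.le h), zero_div]
          positivity
        · refine div_le_div₀ zero_le_one ?_ ha h
          rw [Real.sqrt_le_one]
          have : (s * (1 - s)) ^ (2 / p) ≤ 1 :=
            Real.rpow_le_one hq.le (by linarith) (by positivity)
          nlinarith [sq_nonneg v]
  constructor
  · rw [intervalIntegrable_iff_integrableOn_Ioc_of_le hvW.le]
    exact (hint.integral_prod_right).const_mul (2 / p)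
  · rw [g_eq_setIntegral hp hv hv4, intervalIntegral.integral_of_le hvW.le]
    unfold negDerivG
    rw [integral_const_mul]
    congr 1
    rw [← integral_integral_swap hint]
    exact setIntegral_congr_fun measurableSet_Ioo fun s hs => (inner s hs).2.symm

/-- `s (1 - s)` for `s = 1/2 + √(1/4 - a) sin θ`. -/
noncomputable def sinSub (a θ : ℝ) : ℝ := 1 / 4 - (1 / 4 - a) * sin θ ^ 2

lemma sinSub_eq (a θ : ℝ) : sinSub a θ = a + (1 / 4 - a) * cos θ ^ 2 := by
  unfold sinSub
  rw [Real.sin_sq]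
  ring

/-- The integrand of `negDerivG` after the substitution `s = 1/2 + √(1/4 - u ^ p) sin θ`. -/
noncomputable def kernelG (p u θ : ℝ) : ℝ :=
  u * √(1 / 4 - u ^ p) * cos θ /
    (sinSub (u ^ p) θ * √(sinSub (u ^ p) θ ^ (2 / p) - u ^ 2))

lemma negDerivG_eq {p u : ℝ} (hp : 0 < p) (hu : 0 < u) (hu4 : u ^ p < 1 / 4) :
    negDerivG p u = 2 / p * ∫ θ in Ioo 0 (π / 2), kernelG p u θ := by
  have ha : 0 < u ^ p := Real.rpow_pos_of_pos hu p
  set d := √(1 / 4 - u ^ p) with hd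
  have hd0 : 0 < d := Real.sqrt_pos.mpr (by linarith)
  have hd1 : d < 1 / 2 := by
    rw [hd, Real.sqrt_lt' (by norm_num)]; linarith
  have hd2 : d ^ 2 = 1 / 4 - u ^ p := Real.sq_sqrt (by linarith)
  have himg : (fun θ => 1 / 2 + d * sin θ) '' Ioo 0 (π / 2) = Ioo (1 / 2) (1 / 2 + d) := by
    ext s
    constructor
    · rintro ⟨θ, hθ, rfl⟩
      have h1 : 0 < sin θ := Real.sin_pos_of_pos_of_lt_pi hθ.1 (by linarith [hθ.2, Real.pi_pos])
      have h2 : sin θ < 1 := by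
        rw [← Real.sin_pi_div_two]
        exact Real.sin_lt_sin_of_lt_of_le_pi_div_two (by linarith [hθ.1, Real.pi_pos]) le_rfl hθ.2
      constructor <;> simp only <;> nlinarith
    · intro hs
      have h1 : 0 < (s - 1 / 2) / d := div_pos (by linarith [hs.1]) hd0
      have h2 : (s - 1 / 2) / d < 1 := by rw [div_lt_one hd0]; linarith [hs.2]
      refine ⟨arcsin ((s - 1 / 2) / d), ⟨Real.arcsin_pos.mpr h1, Real.arcsin_lt_pi_div_two.mpr h2⟩,
        ?_⟩
      simp only
      rw [Real.sin_arcsin (by linarith) h2.le]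
      field_simp
      ring
  have hinj : InjOn (fun θ => 1 / 2 + d * sin θ) (Ioo 0 (π / 2)) := by
    intro x hx y hy hxy
    have h : sin x = sin y := mul_left_cancel₀ hd0.ne' (add_left_cancel hxy)
    exact Real.injOn_sin ⟨by linarith [hx.1, Real.pi_pos], hx.2.le⟩
      ⟨by linarith [hy.1, Real.pi_pos], hy.2.le⟩ h
  unfold negDerivG
  congr 1
  rw [setIntegral_eq_of_subset_of_forall_sdiff_eq_zero (s := Ioo (1 / 2 : ℝ) (1 / 2 + d))
    (t := Ioo (1 / 2 : ℝ) 1) measurableSet_Ioo (Ioo_subset_Ioo_right (by linarith)), ← himg,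
    integral_image_eq_integral_abs_deriv_smul (f' := fun θ => d * cos θ) measurableSet_Ioo
      (fun θ _ => (((Real.hasDerivAt_sin θ).const_mul d).const_add _).hasDerivWithinAt) hinj]
  · refine setIntegral_congr_fun measurableSet_Ioo fun θ hθ => ?_
    have hcos : 0 < cos θ := Real.cos_pos_of_mem_Ioo ⟨by linarith [hθ.1, Real.pi_pos], hθ.2⟩
    have hy : (1 / 2 + d * sin θ) * (1 - (1 / 2 + d * sin θ)) = sinSub (u ^ p) θ := by
      unfold sinSub
      rw [← hd2]
      ring
    simp only [kernelG, smul_eq_mul, ← hd]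
    rw [hy, abs_of_pos (by positivity), div_div, mul_comm (√_)]
    ring
  · rintro s ⟨hs, hs'⟩
    have hs2 : 1 / 2 + d ≤ s := by
      by_contra h
      exact hs' ⟨hs.1, not_le.mp h⟩
    rw [Real.sqrt_eq_zero_of_nonpos, div_zero, zero_div]
    exact rpow_sub_sq_nonpos hp hu (by nlinarith [hs.1, hs.2]) (by nlinarith)

lemma sinSub_bounds {a θ : ℝ} (ha : a < 1 / 4) (hθ : θ ∈ Ioo 0 (π / 2)) :
    a < sinSub a θ ∧ sinSub a θ < 1 / 4 := by
  have h1 : 0 < sin θ := Real.sin_pos_of_pos_of_lt_pi hθ.1 (by linarith [hθ.2, Real.pi_pos])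
  have h2 : 0 < cos θ := Real.cos_pos_of_mem_Ioo ⟨by linarith [hθ.1, Real.pi_pos], hθ.2⟩
  constructor
  · rw [sinSub_eq]
    have : 0 < (1 / 4 - a) * cos θ ^ 2 := mul_pos (by linarith) (by positivity)
    linarith
  · unfold sinSub
    have : 0 < (1 / 4 - a) * sin θ ^ 2 := mul_pos (by linarith) (by positivity)
    linarith

lemma rpow_sub_sq_lower_bound {p u y : ℝ} (hp : 0 < p) (hu : 0 < u) (hy : u ^ p < y) :
    u ^ 2 * (2 / p * (1 - u ^ p / y)) ≤ y ^ (2 / p) - u ^ 2 := by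
  have ha : 0 < u ^ p := Real.rpow_pos_of_pos hu p
  have hy0 : 0 < y := ha.trans hy
  have ht : 0 < y / u ^ p := by positivity
  have h1 := Real.one_sub_inv_le_log_of_pos ht
  rw [inv_div] at h1
  have h2 := Real.add_one_le_exp (Real.log (y / u ^ p) * (2 / p))
  rw [← Real.rpow_def_of_pos ht, Real.div_rpow hy0.le ha.le, rpow_rpow_two_div hp hu.le,
    le_div_iff₀ (by positivity)] at h2
  have h3 : u ^ 2 * (2 / p * (1 - u ^ p / y)) ≤ u ^ 2 * (Real.log (y / u ^ p) * (2 / p)) := by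
    rw [mul_comm (Real.log _)]
    gcongr
  linarith

lemma rpow_sub_sq_pos {p u y : ℝ} (hp : 0 < p) (hu : 0 ≤ u) (hy : u ^ p < y) :
    0 < y ^ (2 / p) - u ^ 2 := by
  have := Real.rpow_lt_rpow (by positivity) hy (by positivity : 0 < 2 / p)
  rw [rpow_rpow_two_div hp hu] at this
  linarith

lemma kernelG_nonneg {p u θ : ℝ} (hu : 0 < u) (hu4 : u ^ p < 1 / 4) (hθ : θ ∈ Ioo 0 (π / 2)) :
    0 ≤ kernelG p u θ := by
  have h := (Real.rpow_pos_of_pos hu p).trans (sinSub_bounds hu4 hθ).1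
  have h2 : 0 < cos θ := Real.cos_pos_of_mem_Ioo ⟨by linarith [hθ.1, Real.pi_pos], hθ.2⟩
  unfold kernelG
  positivity

lemma kernelG_le {p u θ : ℝ} (hp : 0 < p) (hu : 0 < u) (hu4 : u ^ p < 1 / 4)
    (hθ : θ ∈ Ioo 0 (π / 2)) :
    kernelG p u θ ≤ √(p / 2) / √(sinSub (u ^ p) θ) := by
  have ha : 0 < u ^ p := Real.rpow_pos_of_pos hu p
  obtain ⟨hy, -⟩ := sinSub_bounds hu4 hθ
  have hcos : 0 < cos θ := Real.cos_pos_of_mem_Ioo ⟨by linarith [hθ.1, Real.pi_pos], hθ.2⟩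
  have hsub := sinSub_eq (u ^ p) θ
  unfold kernelG
  set y := sinSub (u ^ p) θ
  have hy0 : 0 < y := ha.trans hy
  have hpos := rpow_sub_sq_pos hp hu.le hy
  have hlow := rpow_sub_sq_lower_bound hp hu hy
  set D := y ^ (2 / p) - u ^ 2
  have hnum : u * √(1 / 4 - u ^ p) * cos θ ≤ √(p / 2) * √y * √D := by
    rw [← Real.sqrt_mul (by positivity), ← Real.sqrt_mul (by positivity)]
    refine Real.le_sqrt_of_sq_le ?_
    rw [mul_pow, mul_pow, Real.sq_sqrt (by linarith)]
    calc u ^ 2 * (1 / 4 - u ^ p) * cos θ ^ 2 = p / 2 * y * (u ^ 2 * (2 / p * (1 - u ^ p / y))) := by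
          field_simp
          linarith
      _ ≤ p / 2 * y * D := by gcongr
  have hD : 0 < √D := Real.sqrt_pos.mpr hpos
  have hsy : 0 < √y := Real.sqrt_pos.mpr hy0
  rw [div_le_div_iff₀ (by positivity) hsy]
  calc u * √(1 / 4 - u ^ p) * cos θ * √y ≤ √(p / 2) * √y * √D * √y := by gcongr
    _ = √(p / 2) * ((√y * √y) * √D) := by ring
    _ = √(p / 2) * (y * √D) := by rw [Real.mul_self_sqrt hy0.le]

lemma norm_kernelG_le {p u θ a : ℝ} (hp : 0 < p) (hu : 0 < u) (ha : 0 < a) (hau : a ≤ u ^ p)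
    (hu4 : u ^ p < 1 / 4) (hθ : θ ∈ Ioo 0 (π / 2)) :
    ‖kernelG p u θ‖ ≤ √(p / 2) / √a := by
  rw [Real.norm_of_nonneg (kernelG_nonneg hu hu4 hθ)]
  refine (kernelG_le hp hu hu4 hθ).trans ?_
  have := (sinSub_bounds hu4 hθ).1
  have h : 0 < √a := Real.sqrt_pos.mpr ha
  gcongr
  linarith

lemma measurable_kernelG (p u : ℝ) : Measurable (kernelG p u) := by
  unfold kernelG sinSub
  fun_prop

lemma continuousAt_kernelG {p u θ : ℝ} (hp : 0 < p) (hu : 0 ≤ u) (hu4 : u ^ p < 1 / 4)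
    (hθ : θ ∈ Ioo 0 (π / 2)) : ContinuousAt (fun u => kernelG p u θ) u := by
  have hy := (sinSub_bounds hu4 hθ).1
  have hy0 : 0 < sinSub (u ^ p) θ := lt_of_le_of_lt (by positivity) hy
  have hpos := rpow_sub_sq_pos hp hu hy
  have hc : Continuous fun u : ℝ => u ^ p := Real.continuous_rpow_const hp.le
  have hs : Continuous fun u : ℝ => sinSub (u ^ p) θ := by
    unfold sinSub
    fun_prop
  have hs' : Continuous fun u : ℝ => sinSub (u ^ p) θ ^ (2 / p) :=
    hs.rpow_const fun _ => Or.inr (by positivity)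
  unfold kernelG
  refine ContinuousAt.div (by fun_prop) (by fun_prop) ?_
  exact (mul_pos hy0 (Real.sqrt_pos.mpr hpos)).ne'

lemma tendsto_negDerivG_of_tendsto_kernelG {p u₀ : ℝ} {l : Filter ℝ} [l.IsCountablyGenerated]
    (hp : 0 < p) (hu₀ : 0 < u₀) (hl : l ≤ 𝓝 u₀) (hl4 : ∀ᶠ u in l, u ^ p < 1 / 4) {k : ℝ → ℝ}
    (hk : ∀ θ ∈ Ioo 0 (π / 2), Tendsto (fun u => kernelG p u θ) l (𝓝 (k θ))) :
    Tendsto (negDerivG p) l (𝓝 (2 / p * ∫ θ in Ioo 0 (π / 2), k θ)) := by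
  have ha : 0 < u₀ ^ p := Real.rpow_pos_of_pos hu₀ p
  have hpos : ∀ᶠ u in l, 0 < u := hl (lt_mem_nhds hu₀)
  have hlow : ∀ᶠ u in l, u₀ ^ p / 2 ≤ u ^ p :=
    hl ((Real.continuous_rpow_const hp.le).continuousAt.eventually_const_le (by linarith))
  have key : Tendsto (fun u => 2 / p * ∫ θ in Ioo 0 (π / 2), kernelG p u θ) l
      (𝓝 (2 / p * ∫ θ in Ioo 0 (π / 2), k θ)) := by
    refine Tendsto.const_mul _ ?_
    refine tendsto_integral_filter_of_dominated_convergence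
      (fun _ => √(p / 2) / √(u₀ ^ p / 2)) ?_ ?_ (integrable_const _) ?_
    · exact Eventually.of_forall fun u => (measurable_kernelG p u).aestronglyMeasurable
    · filter_upwards [hpos, hlow, hl4] with u h1 h2 h3
      filter_upwards [ae_restrict_mem measurableSet_Ioo] with θ hθ
      exact norm_kernelG_le hp h1 (by positivity) h2 h3 hθ
    · filter_upwards [ae_restrict_mem measurableSet_Ioo] with θ hθ
      exact hk θ hθ
  refine key.congr' ?_
  filter_upwards [hpos, hl4] with u h1 h2
  exact (negDerivG_eq hp h1 h2).symm

lemma continuousAt_negDerivG {p u : ℝ} (hp : 0 < p) (hu : 0 < u) (hu4 : u ^ p < 1 / 4) :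
    ContinuousAt (negDerivG p) u := by
  have h4 : ∀ᶠ x in 𝓝 u, x ^ p < 1 / 4 :=
    (Real.continuous_rpow_const hp.le).continuousAt.eventually_lt_const hu4
  have := tendsto_negDerivG_of_tendsto_kernelG (k := kernelG p u) hp hu le_rfl h4
    fun θ hθ => continuousAt_kernelG hp hu.le hu4 hθ
  rwa [← negDerivG_eq hp hu hu4] at this

lemma deriv_g {p v : ℝ} (hp : 0 < p) (hv : 0 < v) (hvW : v < (1 / 4 : ℝ) ^ (1 / p)) :
    deriv (g p) v = -negDerivG p v := by
  have hmem : Ioo 0 ((1 / 4 : ℝ) ^ (1 / p)) ∈ 𝓝 v := Ioo_mem_nhds hv hvW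
  have hcont : ContinuousOn (negDerivG p) (Ioo 0 ((1 / 4 : ℝ) ^ (1 / p))) := fun u hu =>
    (continuousAt_negDerivG hp hu.1 (rpow_lt_quarter_s7 hp hu.1 hu.2)).continuousWithinAt
  have h := intervalIntegral.integral_hasDerivAt_left (g_eq_integral_negDerivG hp hv hvW).1
    (hcont.stronglyMeasurableAtFilter isOpen_Ioo v ⟨hv, hvW⟩) (hcont.continuousAt hmem)
  refine (h.congr_of_eventuallyEq ?_).deriv
  filter_upwards [hmem] with u hu
  exact (g_eq_integral_negDerivG hp hu.1 hu.2).2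

lemma kernelG_eq_div_sqrt_slope {p u θ : ℝ} (hp : 0 < p) (hu : 0 < u) (hu4 : u ^ p < 1 / 4)
    (hθ : θ ∈ Ioo 0 (π / 2)) :
    kernelG p u θ = √(u ^ p / slope (fun t : ℝ => t ^ (2 / p)) 1 (sinSub (u ^ p) θ / u ^ p)) /
      sinSub (u ^ p) θ := by
  have ha : 0 < u ^ p := Real.rpow_pos_of_pos hu p
  have hy := (sinSub_bounds hu4 hθ).1
  have hcos : 0 < cos θ := Real.cos_pos_of_mem_Ioo ⟨by linarith [hθ.1, Real.pi_pos], hθ.2⟩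
  have hsub := sinSub_eq (u ^ p) θ
  unfold kernelG
  set y := sinSub (u ^ p) θ
  have hy0 : 0 < y := ha.trans hy
  have hpos := rpow_sub_sq_pos hp hu.le hy
  have hnum : u * √(1 / 4 - u ^ p) * cos θ = √(u ^ 2 * (y - u ^ p)) := by
    rw [hsub, add_sub_cancel_left, Real.sqrt_mul (by positivity), Real.sqrt_sq hu.le,
      Real.sqrt_mul (by linarith), Real.sqrt_sq hcos.le, mul_assoc]
  rw [hnum, mul_comm y, ← div_div, ← Real.sqrt_div (by nlinarith), slope_def_field, Real.one_rpow,
    Real.div_rpow hy0.le ha.le, rpow_rpow_two_div hp hu.le]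
  congr 2
  have h1 : y - u ^ p ≠ 0 := by linarith
  have h2 : y ^ (2 / p) - u ^ 2 ≠ 0 := hpos.ne'
  have e1 : y ^ (2 / p) / u ^ 2 - 1 = (y ^ (2 / p) - u ^ 2) / u ^ 2 := by field_simp
  have e2 : y / u ^ p - 1 = (y - u ^ p) / u ^ p := by field_simp
  rw [e1, e2]
  field_simp

lemma tendsto_negDerivG_right {p : ℝ} (hp : 0 < p) :
    Tendsto (negDerivG p) (𝓝[<] ((1 / 4 : ℝ) ^ (1 / p))) (𝓝 (√(2 / p) * π)) := by
  set W := (1 / 4 : ℝ) ^ (1 / p) with hW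
  have hW0 : 0 < W := by positivity
  have hWp : W ^ p = 1 / 4 := by
    rw [hW, ← Real.rpow_mul (by norm_num), one_div_mul_cancel hp.ne', Real.rpow_one]
  have hpos : ∀ᶠ u in 𝓝[<] W, 0 < u := nhdsWithin_le_nhds (lt_mem_nhds hW0)
  have h4 : ∀ᶠ u in 𝓝[<] W, u ^ p < 1 / 4 := by
    filter_upwards [hpos, self_mem_nhdsWithin] with u h1 h2
    exact rpow_lt_quarter_s7 hp h1 h2
  have key := tendsto_negDerivG_of_tendsto_kernelG (k := fun _ => √(1 / 4 / (2 / p)) / (1 / 4))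
    hp hW0 nhdsWithin_le_nhds h4 ?_
  · convert key using 2
    have e : √(1 / 4 / (2 / p)) = p * √(2 / p) / 4 := by
      rw [show 1 / 4 / (2 / p) = (p / 4) ^ 2 * (2 / p) by field_simp; norm_num,
        Real.sqrt_mul (by positivity), Real.sqrt_sq (by positivity)]
      ring
    rw [setIntegral_const, Measure.real, Real.volume_Ioo, sub_zero,
      ENNReal.toReal_ofReal (by positivity), e, smul_eq_mul]
    field_simp
  · intro θ hθ
    have ha : Tendsto (fun u : ℝ => u ^ p) (𝓝[<] W) (𝓝 (1 / 4)) := by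
      rw [← hWp]
      exact (Real.continuous_rpow_const hp.le).continuousAt.tendsto.mono_left nhdsWithin_le_nhds
    have hy : Tendsto (fun u : ℝ => sinSub (u ^ p) θ) (𝓝[<] W) (𝓝 (1 / 4)) := by
      have h := ((ha.const_sub (1 / 4)).mul_const (sin θ ^ 2)).const_sub (1 / 4)
      simpa [sinSub] using h
    have ht : Tendsto (fun u : ℝ => sinSub (u ^ p) θ / u ^ p) (𝓝[<] W) (𝓝[≠] 1) := by
      refine tendsto_nhdsWithin_iff.mpr ⟨?_, ?_⟩
      · have h := hy.div ha (by norm_num)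
        rwa [div_self (by norm_num)] at h
      · filter_upwards [hpos, h4] with u h1 h2
        have h3 := (sinSub_bounds h2 hθ).1
        exact ((one_lt_div (Real.rpow_pos_of_pos h1 p)).mpr h3).ne'
    have hslope := (hasDerivAt_iff_tendsto_slope.mp
      (Real.hasDerivAt_rpow_const (x := 1) (p := 2 / p) (Or.inl one_ne_zero))).comp ht
    rw [Real.one_rpow, mul_one] at hslope
    refine ((ha.div hslope (by positivity)).sqrt.div hy (by norm_num)).congr' ?_
    filter_upwards [hpos, h4] with u h1 h2
    exact (kernelG_eq_div_sqrt_slope hp h1 h2 hθ).symm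

lemma integrableOn_kernelG {p u : ℝ} (hp : 0 < p) (hu : 0 < u) (hu4 : u ^ p < 1 / 4) :
    IntegrableOn (kernelG p u) (Ioo 0 (π / 2)) := by
  refine Measure.integrableOn_of_bounded (by simp) (measurable_kernelG p u).aestronglyMeasurable
    (M := √(p / 2) / √(u ^ p)) ?_
  filter_upwards [ae_restrict_mem measurableSet_Ioo] with θ hθ
  exact norm_kernelG_le hp hu (Real.rpow_pos_of_pos hu p) le_rfl hu4 hθ

lemma integrableOn_sin_mul_kernelG {p u : ℝ} (hp : 0 < p) (hu : 0 < u) (hu4 : u ^ p < 1 / 4) :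
    IntegrableOn (fun θ => 2 * √(1 / 4 - u ^ p) * sin θ * kernelG p u θ) (Ioo 0 (π / 2)) := by
  refine Integrable.bdd_mul (c := 2 * √(1 / 4 - u ^ p)) (integrableOn_kernelG hp hu hu4)
    (by fun_prop) (Eventually.of_forall fun θ => ?_)
  rw [norm_mul, Real.norm_of_nonneg (by positivity)]
  exact mul_le_of_le_one_right (by positivity) (Real.abs_sin_le_one θ)

/-- The singular part of the kernel has the explicit primitive
`-p * arccos (u / y ^ (1 / p))`, where `y = sinSub (u ^ p) θ`. -/
lemma integral_sin_mul_kernelG {p u : ℝ} (hp : 0 < p) (hu : 0 < u) (hu4 : u ^ p < 1 / 4) :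
    ∫ θ in Ioo 0 (π / 2), 2 * √(1 / 4 - u ^ p) * sin θ * kernelG p u θ =
      p * arccos (u * (1 / 4 : ℝ) ^ (-1 / p)) := by
  have ha : 0 < u ^ p := Real.rpow_pos_of_pos hu p
  have hypos : ∀ θ, 0 < sinSub (u ^ p) θ := fun θ => by
    rw [sinSub_eq]
    have : 0 ≤ (1 / 4 - u ^ p) * cos θ ^ 2 := mul_nonneg (by linarith) (sq_nonneg _)
    linarith
  have hπ : 0 ≤ π / 2 := by positivity
  have hcont : Continuous fun θ => -(p * arccos (u * sinSub (u ^ p) θ ^ (-1 / p))) := by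
    have h : Continuous fun θ => sinSub (u ^ p) θ ^ (-1 / p) := by
      refine Continuous.rpow_const ?_ fun θ => Or.inl (hypos θ).ne'
      unfold sinSub
      fun_prop
    exact ((Real.continuous_arccos.comp (continuous_const.mul h)).const_mul p).neg
  have hder : ∀ θ ∈ Ioo 0 (π / 2),
      HasDerivAt (fun θ => -(p * arccos (u * sinSub (u ^ p) θ ^ (-1 / p))))
        (2 * √(1 / 4 - u ^ p) * sin θ * kernelG p u θ) θ := by
    intro θ hθ
    have hy := (sinSub_bounds hu4 hθ).1
    have hD := rpow_sub_sq_pos hp hu.le hy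
    have hd : √(1 / 4 - u ^ p) * √(1 / 4 - u ^ p) = 1 / 4 - u ^ p :=
      Real.mul_self_sqrt (by linarith)
    have h1 : HasDerivAt (fun θ => sinSub (u ^ p) θ)
        (-((1 / 4 - u ^ p) * (2 * sin θ * cos θ))) θ := by
      have := (((Real.hasDerivAt_sin θ).fun_pow 2).const_mul (1 / 4 - u ^ p)).const_sub (1 / 4)
      simpa [sinSub] using this
    have h2 := ((h1.rpow_const (p := -1 / p) (Or.inl (hypos θ).ne')).const_mul u)
    have hsq : 1 - (u * sinSub (u ^ p) θ ^ (-1 / p)) ^ 2 =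
        (sinSub (u ^ p) θ ^ (2 / p) - u ^ 2) * (sinSub (u ^ p) θ ^ (-1 / p)) ^ 2 := by
      have e : sinSub (u ^ p) θ ^ (2 / p) * (sinSub (u ^ p) θ ^ (-1 / p)) ^ 2 = 1 := by
        rw [← Real.rpow_natCast, ← Real.rpow_mul (hypos θ).le, ← Real.rpow_add (hypos θ)]
        have : 2 / p + -1 / p * ((2 : ℕ) : ℝ) = 0 := by push_cast; ring
        rw [this, Real.rpow_zero]
      rw [sub_mul, e]
      ring
    have hz : 0 < sinSub (u ^ p) θ ^ (-1 / p) := Real.rpow_pos_of_pos (hypos θ) _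
    have hx : 0 < 1 - (u * sinSub (u ^ p) θ ^ (-1 / p)) ^ 2 := by
      rw [hsq]
      positivity
    have hx1 : u * sinSub (u ^ p) θ ^ (-1 / p) ≠ -1 := fun h => by rw [h] at hx; norm_num at hx
    have hx2 : u * sinSub (u ^ p) θ ^ (-1 / p) ≠ 1 := fun h => by rw [h] at hx; norm_num at hx
    have h3 := (((Real.hasDerivAt_arccos hx1 hx2).comp θ h2).const_mul p).fun_neg
    refine h3.congr_deriv ?_
    rw [hsq, Real.sqrt_mul hD.le, Real.sqrt_sq hz.le, Real.rpow_sub_one (hypos θ).ne', kernelG]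
    have hy0 := (hypos θ).ne'
    have hs : √(sinSub (u ^ p) θ ^ (2 / p) - u ^ 2) ≠ 0 := (Real.sqrt_pos.mpr hD).ne'
    generalize √(sinSub (u ^ p) θ ^ (2 / p) - u ^ 2) = S at *
    generalize sinSub (u ^ p) θ ^ (-1 / p) = z at *
    generalize √(1 / 4 - u ^ p) = d at *
    rw [← hd]
    field_simp
  rw [← integral_Ioc_eq_integral_Ioo, ← intervalIntegral.integral_of_le hπ,
    intervalIntegral.integral_eq_sub_of_hasDerivAt_of_le hπ hcont.continuousOn hder]
  · have e0 : sinSub (u ^ p) 0 = 1 / 4 := by simp [sinSub]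
    have e1 : sinSub (u ^ p) (π / 2) = u ^ p := by simp [sinSub]
    have e2 : u * (u ^ p) ^ (-1 / p) = 1 := by
      rw [← Real.rpow_mul hu.le, mul_div_cancel₀ _ hp.ne', Real.rpow_neg_one,
        mul_inv_cancel₀ hu.ne']
    rw [e0, e1, e2, Real.arccos_one]
    ring
  · rw [intervalIntegrable_iff_integrableOn_Ioo_of_le hπ]
    exact integrableOn_sin_mul_kernelG hp hu hu4

/-- The regular part of the kernel is bounded uniformly in `u`. -/
lemma norm_one_sub_mul_kernelG_le {p u θ : ℝ} (hp : 0 < p) (hu : 0 < u) (hu4 : u ^ p < 1 / 4)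
    (hθ : θ ∈ Ioo 0 (π / 2)) :
    ‖(1 - 2 * √(1 / 4 - u ^ p) * sin θ) * kernelG p u θ‖ ≤ 2 * √(p / 2) := by
  have ha : 0 < u ^ p := Real.rpow_pos_of_pos hu p
  obtain ⟨hy, hy4⟩ := sinSub_bounds hu4 hθ
  have hy0 := ha.trans hy
  have hsin : 0 < sin θ := Real.sin_pos_of_pos_of_lt_pi hθ.1 (by linarith [hθ.2, Real.pi_pos])
  have hd : √(1 / 4 - u ^ p) ^ 2 = 1 / 4 - u ^ p := Real.sq_sqrt (by linarith)
  have hx0 : 0 ≤ 2 * √(1 / 4 - u ^ p) * sin θ := by positivity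
  have hx : (2 * √(1 / 4 - u ^ p) * sin θ) ^ 2 = 1 - 4 * sinSub (u ^ p) θ := by
    rw [sinSub, mul_pow, mul_pow, hd]
    ring
  have hx1 : 2 * √(1 / 4 - u ^ p) * sin θ ≤ 1 := by nlinarith
  have hs : √(sinSub (u ^ p) θ) ≤ 1 / 2 := by
    rw [Real.sqrt_le_left (by norm_num)]
    linarith
  have hs0 : 0 < √(sinSub (u ^ p) θ) := Real.sqrt_pos.mpr hy0
  have hk := kernelG_nonneg hu hu4 hθ
  rw [Real.norm_of_nonneg (mul_nonneg (by linarith) hk)]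
  calc (1 - 2 * √(1 / 4 - u ^ p) * sin θ) * kernelG p u θ
      ≤ (4 * sinSub (u ^ p) θ) * (√(p / 2) / √(sinSub (u ^ p) θ)) := by
        refine mul_le_mul ?_ (kernelG_le hp hu hu4 hθ) hk (by positivity)
        nlinarith
    _ = 4 * √(p / 2) * √(sinSub (u ^ p) θ) := by
        nth_rewrite 1 [← Real.mul_self_sqrt hy0.le]
        field_simp
    _ ≤ 4 * √(p / 2) * (1 / 2) := by gcongr
    _ = 2 * √(p / 2) := by ring

lemma tendsto_negDerivG_zero {p : ℝ} (hp : 0 < p) :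
    Tendsto (negDerivG p) (𝓝[>] 0) (𝓝 π) := by
  have hc : Continuous fun u : ℝ => u ^ p := Real.continuous_rpow_const hp.le
  have h0 : (0 : ℝ) ^ p = 0 := Real.zero_rpow hp.ne'
  have h4 : ∀ᶠ u in 𝓝[>] (0 : ℝ), u ^ p < 1 / 4 :=
    nhdsWithin_le_nhds (hc.continuousAt.eventually_lt_const (by simp only [h0]; norm_num))
  have hreg : Tendsto
      (fun u => ∫ θ in Ioo 0 (π / 2), (1 - 2 * √(1 / 4 - u ^ p) * sin θ) * kernelG p u θ)
      (𝓝[>] 0) (𝓝 (∫ _ in Ioo 0 (π / 2), (0 : ℝ))) := by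
    refine tendsto_integral_filter_of_dominated_convergence (fun _ => 2 * √(p / 2)) ?_ ?_
      (integrable_const _) ?_
    · refine Eventually.of_forall fun u => Measurable.aestronglyMeasurable ?_
      have := measurable_kernelG p u
      fun_prop
    · filter_upwards [self_mem_nhdsWithin, h4] with u h1 h2
      filter_upwards [ae_restrict_mem measurableSet_Ioo] with θ hθ
      exact norm_one_sub_mul_kernelG_le hp h1 h2 hθ
    · filter_upwards [ae_restrict_mem measurableSet_Ioo] with θ hθ
      have h1 : ContinuousAt (fun u => kernelG p u θ) 0 :=
        continuousAt_kernelG hp le_rfl (by rw [h0]; norm_num) hθ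
      have h2 : ContinuousAt
          (fun u => (1 - 2 * √(1 / 4 - u ^ p) * sin θ) * kernelG p u θ) 0 := by
        fun_prop
      have h3 := h2.tendsto.mono_left (nhdsWithin_le_nhds (s := Ioi 0))
      simpa [kernelG] using h3
  have hsing : Tendsto (fun u : ℝ => p * arccos (u * (1 / 4 : ℝ) ^ (-1 / p))) (𝓝[>] 0)
      (𝓝 (p * (π / 2))) := by
    have h : Continuous fun u : ℝ => p * arccos (u * (1 / 4 : ℝ) ^ (-1 / p)) :=
      (Real.continuous_arccos.comp (continuous_id.mul continuous_const)).const_mul p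
    have h' := h.continuousAt (x := 0) |>.tendsto.mono_left (nhdsWithin_le_nhds (s := Ioi 0))
    simpa using h'
  have key := (hsing.add hreg).const_mul (2 / p)
  rw [integral_zero, add_zero, show 2 / p * (p * (π / 2)) = π by field_simp] at key
  refine key.congr' ?_
  filter_upwards [self_mem_nhdsWithin, h4] with u h1 h2
  have hi := integrableOn_kernelG hp h1 h2
  have hi' := integrableOn_sin_mul_kernelG hp h1 h2
  rw [negDerivG_eq hp h1 h2, ← integral_sin_mul_kernelG hp h1 h2]
  congr 1
  rw [← integral_add hi' ((hi.sub hi').congr_fun (fun θ _ => by simp; ring) measurableSet_Ioo)]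
  congr 1
  funext θ
  ring

end

/-- for `p ≥ 1`, `lim_{v→0⁺} g_p'(v) = −π` and
`lim_{v→((1/4)^(1/p))⁻} g_p'(v) = −√(2/p)·π`. -/
theorem g_deriv_limits (p : ℝ) (hp : 1 ≤ p) :
    Filter.Tendsto (deriv (g p)) (nhdsWithin 0 (Set.Ioi 0)) (nhds (-π)) ∧
    Filter.Tendsto (deriv (g p))
      (nhdsWithin ((1 / 4 : ℝ) ^ (1 / p)) (Set.Iio ((1 / 4 : ℝ) ^ (1 / p))))
      (nhds (-(Real.sqrt (2 / p) * π))) := by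
  have hp0 : 0 < p := by linarith
  have hW : (0 : ℝ) < (1 / 4 : ℝ) ^ (1 / p) := by positivity
  constructor
  · refine (tendsto_negDerivG_zero hp0).neg.congr' ?_
    filter_upwards [Ioo_mem_nhdsGT hW] with v hv
    exact (deriv_g hp0 hv.1 hv.2).symm
  · refine (tendsto_negDerivG_right hp0).neg.congr' ?_
    filter_upwards [Ioo_mem_nhdsLT hW] with v hv
    exact (deriv_g hp0 hv.1 hv.2).symm
end
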